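/- arXiv:1310.7608 — 8 statements merged into one kernel-verified Lean document; each statement's English description precedes it below -/
import Mathlib

section
/- Let K be a Noetherian commutative ring and n ≥ 1 a natural number. Then every Sym(ℕ)-invariant ideal of R_n = K[x_{ij} : 1 ≤ i ≤ n, j ∈ ℕ] is finitely generated as a Sym(ℕ)-invariant ideal. -/
open MvPolynomial

/-- The action of a permutation `σ` of the column index set `ℕ` on the polynomial ring
`R_n = K[x_{ij} : 1 ≤ i ≤ n, j ∈ ℕ]`, given by `σ(x_{ij}) = x_{i σ(j)}`. -/
noncomputable def colPerm (K : Type*) [CommSemiring K] (n : ℕ) (σ : Equiv.Perm ℕ) :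
    MvPolynomial (Fin n × ℕ) K →ₐ[K] MvPolynomial (Fin n × ℕ) K :=
  rename (fun q => (q.1, σ q.2))

/-- The action of a permutation `τ ∈ S_n` of the row index set on
`R_n = K[x_{ij} : 1 ≤ i ≤ n, j ∈ ℕ]`, given by `τ(x_{ij}) = x_{τ(i) j}`. -/
noncomputable def rowPerm (K : Type*) [CommSemiring K] (n : ℕ) (τ : Equiv.Perm (Fin n)) :
    MvPolynomial (Fin n × ℕ) K →ₐ[K] MvPolynomial (Fin n × ℕ) K :=
  rename (fun q => (τ q.1, q.2))

/-- The subalgebra `R̄_n ⊆ R_n` of polynomials symmetric under all row permutations. -/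
noncomputable def symAlg (K : Type*) [CommSemiring K] (n : ℕ) :
    Subalgebra K (MvPolynomial (Fin n × ℕ) K) where
  carrier := {f | ∀ τ : Equiv.Perm (Fin n), rowPerm K n τ f = f}
  mul_mem' := fun {a b} ha hb => fun τ => by rw [map_mul, ha τ, hb τ]
  add_mem' := fun {a b} ha hb => fun τ => by rw [map_add, ha τ, hb τ]
  algebraMap_mem' := fun r => fun τ => by simp [rowPerm]

lemma rowPerm_colPerm (K : Type*) [CommSemiring K] (n : ℕ) (σ : Equiv.Perm ℕ)
    (τ : Equiv.Perm (Fin n)) (f : MvPolynomial (Fin n × ℕ) K) :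
    rowPerm K n τ (colPerm K n σ f) = colPerm K n σ (rowPerm K n τ f) := by
  simp only [rowPerm, colPerm, rename_rename]
  rfl

lemma colPerm_mem_symAlg (K : Type*) [CommSemiring K] (n : ℕ) (σ : Equiv.Perm ℕ)
    {f : MvPolynomial (Fin n × ℕ) K} (hf : f ∈ symAlg K n) :
    colPerm K n σ f ∈ symAlg K n := by
  intro τ
  rw [rowPerm_colPerm, hf τ]

/-- The action of `σ ∈ Sym(ℕ)` restricted to the symmetric subalgebra `R̄_n`. -/
noncomputable def colPermBar (K : Type*) [CommSemiring K] (n : ℕ) (σ : Equiv.Perm ℕ) :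
    symAlg K n →ₐ[K] symAlg K n :=
  ((colPerm K n σ).comp (symAlg K n).val).codRestrict (symAlg K n)
    (fun x => colPerm_mem_symAlg K n σ x.2)

/-- `h_k = Σ_{i=1}^n x_{i1} ⋯ x_{ik}` (with the first `k` columns indexed by `0,…,k-1`). -/
noncomputable def hPoly (K : Type*) [CommSemiring K] (n k : ℕ) : MvPolynomial (Fin n × ℕ) K :=
  ∑ i : Fin n, ∏ j ∈ Finset.range k, X (i, j)

lemma hPoly_mem_symAlg (K : Type*) [CommSemiring K] (n k : ℕ) : hPoly K n k ∈ symAlg K n := by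
  intro τ
  simp only [hPoly, rowPerm, map_sum, map_prod, rename_X]
  exact Equiv.sum_comp τ (fun i => ∏ j ∈ Finset.range k, (X (i, j) : MvPolynomial (Fin n × ℕ) K))

/-- `h_k` as an element of the symmetric subalgebra `R̄_n`. -/
noncomputable def hBar (K : Type*) [CommSemiring K] (n k : ℕ) : symAlg K n :=
  ⟨hPoly K n k, hPoly_mem_symAlg K n k⟩

/-- The monomial order on `R_n` that compares two exponents at the last variable where they differ,
variables being ordered by column first. -/
noncomputable def colMonomialOrder (n : ℕ) : MonomialOrder (Fin n × ℕ) where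
  syn := (MonomialOrder.lex (σ := (ℕ ×ₗ Fin n)ᵒᵈ)).syn
  toSyn := (Finsupp.domCongr (((Equiv.prodComm _ _).trans toLex).trans OrderDual.toDual)).trans
    (MonomialOrder.lex (σ := (ℕ ×ₗ Fin n)ᵒᵈ)).toSyn
  toSyn_monotone := fun _ _ h =>
    (MonomialOrder.lex (σ := (ℕ ×ₗ Fin n)ᵒᵈ)).toSyn_monotone fun _ => h _

lemma colMonomialOrder_lt_iff {n : ℕ} {c d : Fin n × ℕ →₀ ℕ} :
    (colMonomialOrder n).toSyn c < (colMonomialOrder n).toSyn d ↔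
      ∃ i j, (∀ i' j', (j < j' ∨ j = j' ∧ i < i') → c (i', j') = d (i', j')) ∧
        c (i, j) < d (i, j) := by
  refine (Finsupp.Lex.lt_iff (α := (ℕ ×ₗ Fin n)ᵒᵈ) (N := ℕ)).trans ⟨?_, ?_⟩
  · rintro ⟨k, hk, hlt⟩
    refine ⟨(ofLex (OrderDual.ofDual k)).2, (ofLex (OrderDual.ofDual k)).1, fun i' j' h => ?_, hlt⟩
    exact hk (OrderDual.toDual (toLex (j', i')))
      (OrderDual.toDual_lt_toDual.2 (Prod.Lex.lt_iff.2 h))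
  · rintro ⟨i, j, h, hlt⟩
    refine ⟨OrderDual.toDual (toLex (j, i)), fun k hk => ?_, hlt⟩
    exact h _ _ (Prod.Lex.lt_iff.1 (OrderDual.ofDual_lt_ofDual.2 hk))

/-- The map on variable indices of `R_n` that applies `g` to the columns. -/
def colMap (n : ℕ) (g : ℕ → ℕ) (q : Fin n × ℕ) : Fin n × ℕ := (q.1, g q.2)

lemma colMap_injective {n : ℕ} {g : ℕ → ℕ} (hg : Function.Injective g) :
    Function.Injective (colMap n g) := by
  rintro ⟨i, j⟩ ⟨i', j'⟩ h
  simp only [colMap, Prod.mk.injEq] at h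
  rw [h.1, hg h.2]

lemma colMonomialOrder_mapDomain_lt {n : ℕ} (g : ℕ ↪o ℕ) {c d : Fin n × ℕ →₀ ℕ}
    (h : (colMonomialOrder n).toSyn c < (colMonomialOrder n).toSyn d) :
    (colMonomialOrder n).toSyn (c.mapDomain (colMap n g)) <
      (colMonomialOrder n).toSyn (d.mapDomain (colMap n g)) := by
  have hinj : Function.Injective (colMap n g) := colMap_injective g.injective
  rw [colMonomialOrder_lt_iff] at h ⊢
  obtain ⟨i, j, h, hlt⟩ := h
  have key (b : Fin n × ℕ →₀ ℕ) (i j) : b.mapDomain (colMap n g) (i, g j) = b (i, j) :=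
    Finsupp.mapDomain_apply hinj b (i, j)
  refine ⟨i, g j, fun i' j' h' => ?_, by rwa [key, key]⟩
  by_cases hj : j' ∈ Set.range g
  · obtain ⟨j', rfl⟩ := hj
    rw [key, key]
    exact h _ _ (by simpa using h')
  · have hq : (i', j') ∉ Set.range (colMap n g) := by
      rintro ⟨⟨a, b⟩, hab⟩
      exact hj ⟨b, congrArg Prod.snd hab⟩
    rw [Finsupp.mapDomain_of_notMem_range _ _ hq, Finsupp.mapDomain_of_notMem_range _ _ hq]

/-- Divisibility of exponents up to a strictly increasing map of the columns. -/
def ColDvd {n : ℕ} (d e : Fin n × ℕ →₀ ℕ) : Prop :=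
  ∃ g : ℕ ↪o ℕ, ∀ i j, d (i, j) ≤ e (i, g j)

instance (n : ℕ) : IsPreorder (Fin n × ℕ →₀ ℕ) ColDvd where
  refl _ := ⟨RelEmbedding.refl _, fun _ _ => le_rfl⟩
  trans _ _ _ := fun ⟨g, hg⟩ ⟨g', hg'⟩ =>
    ⟨g.trans g', fun i j => (hg i j).trans (hg' i (g j))⟩

lemma wellQuasiOrdered_colDvd (n : ℕ) :
    WellQuasiOrdered (ColDvd : (Fin n × ℕ →₀ ℕ) → (Fin n × ℕ →₀ ℕ) → Prop) := by
  have hbound (d : Fin n × ℕ →₀ ℕ) : ∃ N, ∀ i j, N ≤ j → d (i, j) = 0 := by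
    refine ⟨d.support.sup Prod.snd + 1, fun i j hj => ?_⟩
    by_contra h
    have := Finset.le_sup (f := Prod.snd) (Finsupp.mem_support_iff.2 h)
    simp only at this
    omega
  choose N hN using hbound
  let columns (d : Fin n × ℕ →₀ ℕ) : List (Fin n → ℕ) :=
    (List.range (N d)).map fun j i => d (i, j)
  have hwqo := Set.PartiallyWellOrderedOn.partiallyWellOrderedOn_sublistForall₂
    (· ≤ ·) (Set.isPWO_of_wellQuasiOrderedLE (Set.univ : Set (Fin n → ℕ)))
  intro f
  obtain ⟨a, b, hab, h⟩ := hwqo.exists_lt (f := fun k => columns (f k)) (fun _ _ _ => Set.mem_univ _)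
  refine ⟨a, b, hab, ?_⟩
  obtain ⟨l, hl, hsub⟩ := List.sublistForall₂_iff.1 h
  obtain ⟨g, hg⟩ := List.sublist_iff_exists_orderEmbedding_getElem?_eq.1 hsub
  refine ⟨g, fun i j => ?_⟩
  by_cases hj : N (f a) ≤ j
  · simp [hN _ i j hj]
  have hj₁ : j < (columns (f a)).length := by simpa [columns] using hj
  have hj₂ : j < l.length := hl.length_eq ▸ hj₁
  have hle : (columns (f a))[j] ≤ l[j] := (List.forall₂_iff_get.1 hl).2 j hj₁ hj₂
  have hgj := hg j
  rw [List.getElem?_eq_getElem hj₂] at hgj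
  obtain ⟨hj₃, heq⟩ := List.getElem?_eq_some_iff.1 hgj.symm
  rw [← heq] at hle
  simpa [columns] using hle i

section

variable {K : Type*} [CommRing K] {n : ℕ}

lemma rename_colMap_mem {I : Ideal (MvPolynomial (Fin n × ℕ) K)}
    (hI : ∀ σ : Equiv.Perm ℕ, ∀ f ∈ I, colPerm K n σ f ∈ I) (g : ℕ ↪o ℕ)
    {f : MvPolynomial (Fin n × ℕ) K} (hf : f ∈ I) : rename (colMap n g) f ∈ I := by
  obtain ⟨σ, hσ⟩ := Cardinal.extend_function_of_lt
    (s := ((f.vars.image Prod.snd : Finset ℕ) : Set ℕ))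
    ((Function.Embedding.subtype _).trans g.toEmbedding)
    ((Cardinal.lt_aleph0_of_finite _).trans_eq Cardinal.mk_nat.symm) ⟨Equiv.refl ℕ⟩
  convert hI σ f hf using 1
  refine hom_congr_vars (f₁ := (rename (colMap n g) : _ →ₐ[K] _).toRingHom)
    (f₂ := (colPerm K n σ).toRingHom) (by ext; simp [colPerm]) (fun q hq _ => ?_) rfl
  have := hσ ⟨q.2, by simpa using ⟨q.1, hq⟩⟩
  simp only [AlgHom.toRingHom_eq_coe, RingHom.coe_coe, colPerm, rename_X, colMap]
  rw [this]
  rfl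

/-- The ideal of coefficients at `x^d` of those elements of `I` all of whose exponents are at most
`d`. -/
noncomputable def leadIdeal (I : Ideal (MvPolynomial (Fin n × ℕ) K)) (d : Fin n × ℕ →₀ ℕ) :
    Ideal K :=
  Submodule.map (lcoeff K d) (I.restrictScalars K ⊓
    restrictSupport K {c | (colMonomialOrder n).toSyn c ≤ (colMonomialOrder n).toSyn d})

lemma mem_leadIdeal {I : Ideal (MvPolynomial (Fin n × ℕ) K)} {d : Fin n × ℕ →₀ ℕ} {a : K} :
    a ∈ leadIdeal I d ↔ ∃ f ∈ I, (∀ c ∈ f.support,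
      (colMonomialOrder n).toSyn c ≤ (colMonomialOrder n).toSyn d) ∧ coeff d f = a := by
  simp only [leadIdeal, Submodule.mem_map, Submodule.mem_inf, Submodule.restrictScalars_mem,
    mem_restrictSupport_iff, and_assoc]
  rfl

lemma leadIdeal_mono_right {I : Ideal (MvPolynomial (Fin n × ℕ) K)}
    (hI : ∀ σ : Equiv.Perm ℕ, ∀ f ∈ I, colPerm K n σ f ∈ I) {d e : Fin n × ℕ →₀ ℕ}
    (h : ColDvd d e) : leadIdeal I d ≤ leadIdeal I e := by
  obtain ⟨g, hg⟩ := h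
  have hinj : Function.Injective (colMap n g) := colMap_injective g.injective
  have hle : d.mapDomain (colMap n g) ≤ e := by
    intro q
    by_cases hq : q ∈ Set.range (colMap n g)
    · obtain ⟨q, rfl⟩ := hq
      rw [Finsupp.mapDomain_apply hinj]
      exact hg q.1 q.2
    · simp [Finsupp.mapDomain_of_notMem_range _ _ hq]
  obtain ⟨m, rfl⟩ := exists_add_of_le hle
  intro a ha
  obtain ⟨f, hf, hsupp, rfl⟩ := mem_leadIdeal.1 ha
  refine mem_leadIdeal.2 ⟨rename (colMap n g) f * monomial m 1,
    I.mul_mem_right _ (rename_colMap_mem hI g hf), fun c hc => ?_, ?_⟩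
  · classical
    obtain ⟨c₁, hc₁, c₂, hc₂, rfl⟩ := Finset.mem_add.1 (support_mul _ _ hc)
    rw [support_rename_of_injective hinj] at hc₁
    obtain ⟨b, hb, rfl⟩ := Finset.mem_image.1 hc₁
    obtain rfl : c₂ = m := by simpa using support_monomial_subset hc₂
    rw [map_add, map_add]
    refine add_le_add_left ?_ _
    rcases (hsupp b hb).eq_or_lt with h | h
    · rw [(colMonomialOrder n).toSyn.injective h]
    · exact (colMonomialOrder_mapDomain_lt g h).le
  · rw [coeff_mul_monomial, mul_one, coeff_rename_mapDomain _ hinj]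

lemma le_of_leadIdeal_le {I J : Ideal (MvPolynomial (Fin n × ℕ) K)} (hJI : J ≤ I)
    (h : ∀ d, leadIdeal I d ≤ leadIdeal J d) : I ≤ J := by
  intro f hf
  induction hs : (colMonomialOrder n).toSyn ((colMonomialOrder n).degree f) using
    WellFoundedLT.induction generalizing f with
  | ind s ih =>
    subst hs
    obtain ⟨p, hp, hsupp, hcoeff⟩ := mem_leadIdeal.1 (h _ (mem_leadIdeal.2
      ⟨f, hf, fun c hc => (colMonomialOrder n).le_degree hc, rfl⟩))
    by_cases hzero : f - p = 0
    · rwa [sub_eq_zero.1 hzero]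
    have hmem := (colMonomialOrder n).degree_mem_support hzero
    have hle : (colMonomialOrder n).toSyn ((colMonomialOrder n).degree (f - p)) ≤
        (colMonomialOrder n).toSyn ((colMonomialOrder n).degree f) := by
      classical
      rcases Finset.mem_union.1 (support_sub _ f p hmem) with h | h
      · exact (colMonomialOrder n).le_degree h
      · exact hsupp _ h
    have hlt := hle.lt_of_ne fun heq => by
      rw [mem_support_iff, (colMonomialOrder n).toSyn.injective heq, coeff_sub, hcoeff,
        sub_self] at hmem
      exact hmem rfl
    have := ih _ hlt (I.sub_mem hf (hJI hp)) rfl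
    simpa using J.add_mem this hp

/-- A relation that meets every sequence has a finite dominating set. -/
lemma WellQuasiOrdered.exists_finset {α : Type*} {r : α → α → Prop} (h : WellQuasiOrdered r) :
    ∃ D : Finset α, ∀ e, ∃ d ∈ D, r d e := by
  by_contra! hD
  obtain ⟨f, -, hf⟩ := exists_seq_of_forall_finset_exists (fun _ => True) (fun a b => ¬ r a b)
    fun s _ => (hD s).imp fun e he => ⟨trivial, he⟩
  obtain ⟨a, b, hab, hr⟩ := h f
  exact hf a b hab hr

lemma exists_finset_leadIdeal_le [IsNoetherianRing K] {I : Ideal (MvPolynomial (Fin n × ℕ) K)}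
    (hI : ∀ σ : Equiv.Perm ℕ, ∀ f ∈ I, colPerm K n σ f ∈ I) :
    ∃ D : Finset (Fin n × ℕ →₀ ℕ), ∀ e, ∃ d ∈ D, ColDvd d e ∧ leadIdeal I e ≤ leadIdeal I d := by
  refine WellQuasiOrdered.exists_finset fun f => ?_
  obtain ⟨g, hg⟩ := (wellQuasiOrdered_colDvd n).exists_monotone_subseq f
  obtain ⟨k, hk⟩ := monotone_stabilizes_iff_noetherian.2 (inferInstanceAs (IsNoetherian K K))
    ⟨fun k => leadIdeal I (f (g k)), fun a b hab => leadIdeal_mono_right hI (hg a b hab)⟩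
  exact ⟨g k, g (k + 1), g.strictMono k.lt_succ_self, hg _ _ k.le_succ, (hk _ k.le_succ).ge⟩

lemma exists_finset_subset_leadIdeal_le [IsNoetherianRing K]
    (I : Ideal (MvPolynomial (Fin n × ℕ) K)) (d : Fin n × ℕ →₀ ℕ) :
    ∃ T : Finset (MvPolynomial (Fin n × ℕ) K), (T : Set (MvPolynomial (Fin n × ℕ) K)) ⊆ I ∧
      ∀ J : Ideal (MvPolynomial (Fin n × ℕ) K), (T : Set (MvPolynomial (Fin n × ℕ) K)) ⊆ J →
        leadIdeal I d ≤ leadIdeal J d := by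
  classical
  obtain ⟨S, hS⟩ := IsNoetherian.noetherian (leadIdeal I d)
  have hsub : (S : Set K) ⊆ leadIdeal I d := hS ▸ Submodule.subset_span
  obtain ⟨T, hT, rfl⟩ := Finset.subset_set_image_iff.1 (hsub.trans (Submodule.map_coe _ _).subset)
  refine ⟨T, fun f hf => (hT hf).1, fun J hJ => ?_⟩
  rw [← hS, Submodule.span_le, Finset.coe_image]
  rintro _ ⟨f, hf, rfl⟩
  exact ⟨f, ⟨hJ hf, (hT hf).2⟩, rfl⟩

end

/-- Cohen; Aschenbrenner–Hillar; Hillar–Sullivant.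
Over a Noetherian commutative ring `K`, every `Sym(ℕ)`-invariant ideal of
`R_n = K[x_{ij} : 1 ≤ i ≤ n, j ∈ ℕ]` is finitely generated as a `Sym(ℕ)`-invariant ideal. -/
theorem symInvariant_ideal_fg_of_noetherian
    (K : Type) [CommRing K] [IsNoetherianRing K] (n : ℕ) (hn : 1 ≤ n)
    (I : Ideal (MvPolynomial (Fin n × ℕ) K))
    (hI : ∀ σ : Equiv.Perm ℕ, Ideal.map (colPerm K n σ) I = I) :
    ∃ B : Finset (MvPolynomial (Fin n × ℕ) K), (↑B : Set (MvPolynomial (Fin n × ℕ) K)) ⊆ I ∧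
      I = Ideal.span {y | ∃ σ : Equiv.Perm ℕ, ∃ b ∈ B, y = colPerm K n σ b} := by
  classical
  have hI' (σ : Equiv.Perm ℕ) (f) (hf : f ∈ I) : colPerm K n σ f ∈ I :=
    hI σ ▸ Ideal.mem_map_of_mem _ hf
  obtain ⟨D, hD⟩ := exists_finset_leadIdeal_le hI'
  choose T hTI hT using exists_finset_subset_leadIdeal_le I
  have hBI : ((D.biUnion T : Finset _) : Set (MvPolynomial (Fin n × ℕ) K)) ⊆ I := by
    rw [Finset.coe_biUnion]
    exact Set.iUnion₂_subset fun d _ => hTI d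
  refine ⟨D.biUnion T, hBI, ?_⟩
  set J := Ideal.span {y | ∃ σ : Equiv.Perm ℕ, ∃ b ∈ D.biUnion T, y = colPerm K n σ b} with hJdef
  have hJI : J ≤ I := by
    refine Ideal.span_le.2 ?_
    rintro _ ⟨σ, b, hb, rfl⟩
    exact hI' σ b (hBI hb)
  have hJ (σ : Equiv.Perm ℕ) (f) (hf : f ∈ J) : colPerm K n σ f ∈ J := by
    refine (Ideal.map_le_iff_le_comap.1 ?_ : J ≤ J.comap (colPerm K n σ)) hf
    rw [hJdef, Ideal.map_span, Ideal.span_le]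
    rintro _ ⟨_, ⟨τ, b, hb, rfl⟩, rfl⟩
    refine Ideal.subset_span ⟨τ.trans σ, b, hb, ?_⟩
    simp only [colPerm, rename_rename]
    rfl
  have hBJ {b} (hb : b ∈ D.biUnion T) : b ∈ J :=
    Ideal.subset_span ⟨1, b, hb, (rename_id_apply b).symm⟩
  refine le_antisymm (le_of_leadIdeal_le hJI fun e => ?_) hJI
  obtain ⟨d, hd, hde, hle⟩ := hD e
  exact hle.trans ((hT d J fun b hb => hBJ (Finset.mem_biUnion.2 ⟨d, hd, hb⟩)).trans
    (leadIdeal_mono_right hJ hde))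
end

section
/- Let K be a field of characteristic 0 and n ≥ 1. Then every Sym(ℕ)-invariant ideal of the determinantal subalgebra L_n is finitely generated as a Sym(ℕ)-invariant ideal of L_n. -/
open MvPolynomial

/-- The determinant `d_{i_1 … i_n} = det((x_{a i_b})_{a,b})` as an element of `R_n`. -/
noncomputable def dPoly (K : Type*) [CommRing K] (n : ℕ) (ι : Fin n → ℕ) :
    MvPolynomial (Fin n × ℕ) K :=
  Matrix.det (Matrix.of fun a b : Fin n => (X (a, ι b) : MvPolynomial (Fin n × ℕ) K))

/-- The subalgebra `L_n` of `R_n` generated by all the determinants `d_{i_1 … i_n}`. -/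
noncomputable def detAlg (K : Type*) [CommRing K] (n : ℕ) :
    Subalgebra K (MvPolynomial (Fin n × ℕ) K) :=
  Algebra.adjoin K {f | ∃ ι : Fin n → ℕ, f = dPoly K n ι}

lemma colPerm_dPoly (K : Type*) [CommRing K] (n : ℕ) (σ : Equiv.Perm ℕ) (ι : Fin n → ℕ) :
    colPerm K n σ (dPoly K n ι) = dPoly K n (σ ∘ ι) := by
  simp only [dPoly]
  rw [show (colPerm K n σ) (Matrix.det (Matrix.of fun a b : Fin n => (X (a, ι b) : MvPolynomial (Fin n × ℕ) K)))
      = Matrix.det ((Matrix.of fun a b : Fin n => (X (a, ι b) : MvPolynomial (Fin n × ℕ) K)).map (colPerm K n σ))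
    from RingHom.map_det (colPerm K n σ).toRingHom _]
  congr 1
  ext a b
  simp [colPerm, Matrix.map_apply]

lemma colPerm_mem_detAlg (K : Type*) [CommRing K] (n : ℕ) (σ : Equiv.Perm ℕ)
    {f : MvPolynomial (Fin n × ℕ) K} (hf : f ∈ detAlg K n) :
    colPerm K n σ f ∈ detAlg K n := by
  have hle : (detAlg K n).map (colPerm K n σ) ≤ detAlg K n := by
    rw [detAlg, AlgHom.map_adjoin]
    apply Algebra.adjoin_mono
    rintro _ ⟨g, ⟨ι, rfl⟩, rfl⟩
    exact ⟨σ ∘ ι, (colPerm_dPoly K n σ ι).symm ▸ rfl⟩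
  exact hle ⟨f, hf, rfl⟩

/-- The action of `σ ∈ Sym(ℕ)` restricted to `L_n`. -/
noncomputable def colPermDet (K : Type*) [CommRing K] (n : ℕ) (σ : Equiv.Perm ℕ) :
    detAlg K n →ₐ[K] detAlg K n :=
  ((colPerm K n σ).comp (detAlg K n).val).codRestrict (detAlg K n)
    (fun x => colPerm_mem_detAlg K n σ x.2)

open scoped MonomialOrder in
/-- A Gröbner basis argument: if monomials are well-quasi-ordered under divisibility up to a
family `P` of substitutions of variables compatible with a monomial order, then every ideal stable
under `P` is generated by the images under `P` of finitely many elements. -/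
theorem MonomialOrder.exists_finset_le_span_rename {σ K : Type*} [Field K] (m : MonomialOrder σ)
    (P : Set (σ → σ)) (hinj : ∀ p ∈ P, Function.Injective p)
    (hmono : ∀ p ∈ P, ∀ a b : σ →₀ ℕ, a ≺[m] b → a.mapDomain p ≺[m] b.mapDomain p)
    (hwqo : WellQuasiOrdered fun a b : σ →₀ ℕ => ∃ p ∈ P, a.mapDomain p ≤ b)
    (J : Ideal (MvPolynomial σ K)) (hJ : ∀ p ∈ P, ∀ f ∈ J, rename p f ∈ J) :
    ∃ B : Finset (MvPolynomial σ K), (B : Set (MvPolynomial σ K)) ⊆ J ∧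
      J ≤ Ideal.span {f | ∃ p ∈ P, ∃ b ∈ B, f = rename p b} := by
  have hdeg : ∀ p ∈ P, ∀ f : MvPolynomial σ K,
      m.degree (rename p f) = (m.degree f).mapDomain p := by
    intro p hp f
    by_cases hf : f = 0
    · simp [hf]
    apply m.toSyn.injective
    apply le_antisymm
    · rw [m.degree_le_iff]
      intro c hc
      obtain ⟨u, rfl, hu⟩ := coeff_rename_ne_zero p f c (mem_support_iff.mp hc)
      rcases (m.le_degree (mem_support_iff.mpr hu)).lt_or_eq with h | h
      · exact (hmono p hp _ _ h).le
      · rw [m.toSyn.injective h]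
    · apply m.le_degree
      rw [mem_support_iff, coeff_rename_mapDomain p (hinj p hp)]
      exact m.coeff_degree_ne_zero_iff.mpr hf
  obtain ⟨B, hBJ, hB⟩ : ∃ B : Finset (MvPolynomial σ K), (∀ b ∈ B, b ∈ J ∧ b ≠ 0) ∧
      ∀ f, f ∈ J ∧ f ≠ 0 → ∃ b ∈ B, ∃ p ∈ P, (m.degree b).mapDomain p ≤ m.degree f := by
    by_contra! hcon
    obtain ⟨s, -, hs⟩ := exists_seq_of_forall_finset_exists (fun f => f ∈ J ∧ f ≠ 0)
      (fun b f => ∀ p ∈ P, ¬ (m.degree b).mapDomain p ≤ m.degree f) hcon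
    obtain ⟨i, j, hij, p, hp, hle⟩ := hwqo fun k => m.degree (s k)
    exact hs i j hij p hp hle
  refine ⟨B, fun b hb => (hBJ b hb).1, ?_⟩
  suffices H : ∀ d : m.syn, ∀ f ∈ J, m.toSyn (m.degree f) = d →
      f ∈ Ideal.span {f | ∃ p ∈ P, ∃ b ∈ B, f = rename p b} from fun f hf => H _ f hf rfl
  intro d
  induction d using WellFoundedLT.induction with
  | ind d ih =>
    rintro f hf rfl
    by_cases hf0 : f = 0
    · rw [hf0]; exact zero_mem _
    obtain ⟨b, hb, p, hp, hle⟩ := hB f ⟨hf, hf0⟩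
    have hgen : rename p b ∈ Ideal.span {f | ∃ p ∈ P, ∃ b ∈ B, f = rename p b} :=
      Ideal.subset_span ⟨p, hp, b, hb, rfl⟩
    rw [← hdeg p hp] at hle
    have hb0 : rename p b ≠ 0 :=
      (map_ne_zero_iff _ (rename_injective p (hinj p hp))).mpr (hBJ b hb).2
    have hu : IsUnit (m.leadingCoeff (rename p b)) :=
      (m.leadingCoeff_ne_zero_iff.mpr hb0).isUnit
    by_cases hd : m.degree f = 0
    · have hb1 : m.degree (rename p b) = 0 := le_antisymm (hd ▸ hle) bot_le
      have hfb : f = C (m.leadingCoeff f / m.leadingCoeff (rename p b)) * rename p b := by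
        have h1 := m.eq_C_of_degree_eq_zero hd
        have h2 := m.eq_C_of_degree_eq_zero hb1
        conv_lhs => rw [h1]
        conv_rhs => rw [h2]
        rw [m.leadingCoeff_C, ← C_mul, div_mul_cancel₀ _ hu.ne_zero]
      rw [hfb]
      exact Ideal.mul_mem_left _ _ hgen
    · have hlt := m.degree_reduce_lt hu hle hd
      have hmul := fun q => Ideal.mul_mem_left _ q hgen
      have hred := ih _ hlt (m.reduce hu f)
        (J.sub_mem hf (J.mul_mem_left _ (hJ p hp b (hBJ b hb).1))) rfl
      rw [MonomialOrder.reduce] at hred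
      exact (Submodule.sub_mem_iff_left _ (hmul _)).mp hred

/-- The substitution of column indices of the variables `x_{ij}`. -/
def mapCol {n : ℕ} (g : ℕ → ℕ) (q : Fin n × ℕ) : Fin n × ℕ := (q.1, g q.2)

lemma mapCol_injective {n : ℕ} {g : ℕ → ℕ} (hg : Function.Injective g) :
    Function.Injective (mapCol (n := n) g) := fun a b h => by
  simp only [mapCol, Prod.mk.injEq] at h
  exact Prod.ext h.1 (hg h.2)

open scoped MonomialOrder in
/-- There is a monomial order on `K[x_{ij}]` compatible with increasing column substitutions. -/
lemma exists_monomialOrder_mapCol (n : ℕ) : ∃ m : MonomialOrder.{0, 0} (Fin n × ℕ),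
    ∀ (g : ℕ ↪o ℕ) (a b : Fin n × ℕ →₀ ℕ), a ≺[m] b →
      a.mapDomain (mapCol g) ≺[m] b.mapDomain (mapCol g) := by
  let e : Fin n × ℕ → (ℕ ×ₗ Fin n)ᵒᵈ := fun q => OrderDual.toDual (toLex (q.2, q.1))
  have he : Function.Injective e := by
    intro a b h
    have h' : (a.2, a.1) = (b.2, b.1) := h
    simp only [Prod.mk.injEq] at h'
    exact Prod.ext h'.2 h'.1
  let lo : LinearOrder (Fin n × ℕ) := LinearOrder.lift' e he
  have hwf : @WellFoundedGT (Fin n × ℕ) lo.toLT :=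
    ⟨InvImage.wf e (wellFounded_gt (α := (ℕ ×ₗ Fin n)ᵒᵈ))⟩
  refine ⟨@MonomialOrder.lex _ lo hwf, fun g a b hab => ?_⟩
  have hg := mapCol_injective (n := n) g.injective
  have hlt : ∀ q r : Fin n × ℕ, lo.lt q r ↔ r.2 < q.2 ∨ r.2 = q.2 ∧ r.1 < q.1 := by
    intro q r
    change toLex (r.2, r.1) < toLex (q.2, q.1) ↔ _
    exact Prod.Lex.toLex_lt_toLex
  obtain ⟨q, hq, hlt'⟩ := hab
  refine ⟨mapCol g q, fun r hr => ?_, ?_⟩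
  · change Finsupp.mapDomain _ a r = Finsupp.mapDomain _ b r
    by_cases hr' : r ∈ Set.range (mapCol g)
    · obtain ⟨r, rfl⟩ := hr'
      rw [Finsupp.mapDomain_apply hg, Finsupp.mapDomain_apply hg]
      refine hq r ((hlt _ _).mpr ?_)
      simpa [mapCol] using (hlt _ _).mp hr
    · rw [Finsupp.mapDomain_of_notMem_range _ _ hr', Finsupp.mapDomain_of_notMem_range _ _ hr']
  · change Finsupp.mapDomain _ a _ < Finsupp.mapDomain _ b _
    rw [Finsupp.mapDomain_apply hg, Finsupp.mapDomain_apply hg]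
    exact hlt'

/-- Higman's lemma for monomials in the variables `x_{ij}`. -/
lemma wellQuasiOrdered_mapCol (n : ℕ) : WellQuasiOrdered fun a b : Fin n × ℕ →₀ ℕ =>
    ∃ p ∈ {p | ∃ g : ℕ ↪o ℕ, p = mapCol g}, a.mapDomain p ≤ b := by
  intro s
  have hbd : ∀ a : Fin n × ℕ →₀ ℕ, ∃ N, ∀ q, N ≤ q.2 → a q = 0 := by
    intro a
    refine ⟨a.support.sup Prod.snd + 1, fun q hq => ?_⟩
    by_contra h
    have := Finset.le_sup (f := Prod.snd) (Finsupp.mem_support_iff.mpr h)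
    omega
  choose N hN using hbd
  let w : (Fin n × ℕ →₀ ℕ) → List (Fin n → ℕ) :=
    fun a => (List.range (N a)).map fun j i => a (i, j)
  have hpwo : (Set.univ : Set (Fin n → ℕ)).IsPWO := by
    rw [← Set.pi_univ Set.univ]
    exact Set.IsPWO.pi fun i => Set.isPWO_of_wellQuasiOrderedLE _
  have hhig := Set.PartiallyWellOrderedOn.partiallyWellOrderedOn_sublistForall₂ (· ≤ ·) hpwo
  obtain ⟨i, j, hij, h⟩ := hhig fun k => ⟨w (s k), fun _ _ => Set.mem_univ _⟩
  refine ⟨i, j, hij, ?_⟩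
  obtain ⟨l, hl, hsub⟩ := List.sublistForall₂_iff.mp h
  obtain ⟨g, hg⟩ := List.sublist_iff_exists_orderEmbedding_getElem?_eq.mp hsub
  refine ⟨_, ⟨g, rfl⟩, fun q => ?_⟩
  by_cases hq : q ∈ Set.range (mapCol g)
  · obtain ⟨⟨c, k⟩, rfl⟩ := hq
    rw [Finsupp.mapDomain_apply (mapCol_injective g.injective)]
    by_cases hk : N (s i) ≤ k
    · rw [hN _ _ hk]; exact Nat.zero_le _
    have hk1 : k < (w (s i)).length := by simpa [w] using hk
    have hk2 : k < l.length := hl.length_eq ▸ hk1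
    have hle := hl.get hk1 hk2
    have hk3 := hg k
    rw [List.getElem?_eq_getElem hk2, eq_comm, List.getElem?_eq_some_iff] at hk3
    obtain ⟨hk4, hk5⟩ := hk3
    simp only [List.get_eq_getElem] at hle
    rw [← hk5] at hle
    simpa [w, mapCol] using hle c
  · rw [Finsupp.mapDomain_of_notMem_range _ _ hq]; exact Nat.zero_le _

/-- On a given polynomial, an injective substitution of column indices agrees with a
permutation. -/
lemma exists_colPerm_eq_rename {K : Type*} [CommSemiring K] {n : ℕ} {g : ℕ → ℕ}
    (hg : Function.Injective g) (f : MvPolynomial (Fin n × ℕ) K) :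
    ∃ σ : Equiv.Perm ℕ, rename (mapCol g) f = colPerm K n σ f := by
  let N := f.vars.sup Prod.snd + 1
  have := Equiv.Perm.isMultiplyPretransitive ℕ N
  obtain ⟨σ, hσ⟩ := MulAction.exists_smul_eq (Equiv.Perm ℕ)
    (Fin.valEmbedding (n := N)) (Fin.valEmbedding.trans ⟨g, hg⟩)
  refine ⟨σ, ?_⟩
  rw [colPerm, rename_eq_aeval, rename_eq_aeval]
  refine eval₂Hom_congr' rfl (fun q hq _ => ?_) rfl
  have hqN : q.2 < N := Nat.lt_succ_of_le (Finset.le_sup (f := Prod.snd) hq)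
  have := DFunLike.congr_fun hσ ⟨q.2, hqN⟩
  have hσq : σ q.2 = g q.2 := this
  simp [mapCol, hσq]

/-- Every ideal of `K[x_{ij}]` stable under `Sym(ℕ)` is generated by finitely many orbits. -/
theorem exists_finset_le_span_colPerm {K : Type*} [Field K] {n : ℕ}
    (J : Ideal (MvPolynomial (Fin n × ℕ) K)) (hJ : ∀ σ, ∀ f ∈ J, colPerm K n σ f ∈ J) :
    ∃ B : Finset (MvPolynomial (Fin n × ℕ) K), (B : Set (MvPolynomial (Fin n × ℕ) K)) ⊆ J ∧
      J ≤ Ideal.span {f | ∃ σ, ∃ b ∈ B, f = colPerm K n σ b} := by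
  obtain ⟨m, hm⟩ := exists_monomialOrder_mapCol n
  obtain ⟨B, hBJ, hB⟩ := m.exists_finset_le_span_rename {p | ∃ g : ℕ ↪o ℕ, p = mapCol g}
    (by rintro _ ⟨g, rfl⟩; exact mapCol_injective g.injective)
    (by rintro _ ⟨g, rfl⟩; exact hm g) (wellQuasiOrdered_mapCol n) J (by
      rintro _ ⟨g, rfl⟩ f hf
      obtain ⟨σ, hσ⟩ := exists_colPerm_eq_rename g.injective f
      exact hσ ▸ hJ σ f hf)
  refine ⟨B, hBJ, hB.trans (Ideal.span_mono ?_)⟩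
  rintro _ ⟨_, ⟨g, rfl⟩, b, hb, rfl⟩
  obtain ⟨σ, hσ⟩ := exists_colPerm_eq_rename g.injective b
  exact ⟨σ, b, hb, hσ⟩

namespace MvPolynomial

variable {σ τ S : Type*} [CommRing S]

section Apolar

variable [Fintype σ]

/-- The apolar (Fischer) bilinear form `⟨P, F⟩ = ∑ α, α! P_α F_α` on polynomials. -/
noncomputable def apolar : MvPolynomial σ S →ₗ[S] MvPolynomial σ S →ₗ[S] S :=
  (basisMonomials σ S).constr S fun α => (∏ i, ((α i).factorial : S)) • lcoeff S α

lemma apolar_monomial (α : σ →₀ ℕ) (c : S) (F : MvPolynomial σ S) :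
    apolar (monomial α c) F = c * ((∏ i, ((α i).factorial : S)) * coeff α F) := by
  have h : monomial α c = c • basisMonomials σ S α := by
    simp [smul_monomial]
  rw [h, map_smul, apolar, Module.Basis.constr_basis]
  simp

lemma apolar_eq_sum (P F : MvPolynomial σ S) :
    apolar P F = ∑ α ∈ P.support, coeff α P * ((∏ i, ((α i).factorial : S)) * coeff α F) := by
  conv_lhs => rw [P.as_sum, map_sum, LinearMap.sum_apply]
  exact Finset.sum_congr rfl fun α _ => apolar_monomial _ _ _

lemma apolar_monomial_right (P : MvPolynomial σ S) (α : σ →₀ ℕ) (c : S) :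
    apolar P (monomial α c) = c * ((∏ i, ((α i).factorial : S)) * coeff α P) := by
  classical
  induction P using MvPolynomial.induction_on' with
  | monomial β b =>
    rw [apolar_monomial, coeff_monomial, coeff_monomial]
    by_cases h : α = β
    · subst h; simp; ring
    · simp [h, Ne.symm h]
  | add P Q hP hQ => rw [map_add, LinearMap.add_apply, hP, hQ, coeff_add]; ring

lemma apolar_comm (P F : MvPolynomial σ S) : apolar P F = apolar F P := by
  induction P using MvPolynomial.induction_on' with
  | monomial α c => rw [apolar_monomial, apolar_monomial_right]
  | add P Q hP hQ => rw [map_add, LinearMap.add_apply, hP, hQ, map_add]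

lemma apolar_C_mul (c : S) (P F : MvPolynomial σ S) : apolar (C c * P) F = c * apolar P F := by
  rw [← smul_eq_C_mul, map_smul, LinearMap.smul_apply, smul_eq_mul]

lemma apolar_mul_C (c : S) (P F : MvPolynomial σ S) : apolar P (C c * F) = c * apolar P F := by
  rw [← smul_eq_C_mul, map_smul, smul_eq_mul]

lemma apolar_C_left (c : S) (F : MvPolynomial σ S) : apolar (C c) F = c * constantCoeff F := by
  rw [C_apply, apolar_monomial, constantCoeff_eq]
  simp

lemma apolar_one_one : apolar (1 : MvPolynomial σ S) 1 = 1 := by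
  rw [← C_1, apolar_C_left]
  simp

/-- Multiplication by a variable is adjoint to the partial derivative. -/
lemma apolar_mul_X (P F : MvPolynomial σ S) (i : σ) :
    apolar (P * X i) F = apolar P (pderiv i F) := by
  classical
  induction P using MvPolynomial.induction_on' with
  | monomial α c =>
    have hfac : ∏ j, (((α + Finsupp.single i 1 : σ →₀ ℕ) j).factorial : S) =
        (α i + 1) * ∏ j, ((α j).factorial : S) := by
      rw [← Finset.mul_prod_erase _ _ (Finset.mem_univ i),
        ← Finset.mul_prod_erase (a := i) Finset.univ (fun j => ((α j).factorial : S))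
          (Finset.mem_univ i), ← mul_assoc]
      congr 1
      · simp [Nat.factorial_succ]
      · refine Finset.prod_congr rfl fun j hj => ?_
        simp [(Finset.ne_of_mem_erase hj).symm]
    rw [X, monomial_mul, mul_one, apolar_monomial, apolar_monomial, coeff_pderiv, hfac]
    ring
  | add P Q hP hQ => rw [add_mul, map_add, LinearMap.add_apply, hP, hQ, map_add,
      LinearMap.add_apply]

/-- Nondegeneracy of the apolar form in characteristic zero. -/
lemma eq_of_apolar_eq [NoZeroDivisors S] [CharZero S] {P Q : MvPolynomial σ S}
    (h : ∀ F, apolar P F = apolar Q F) : P = Q := by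
  ext α
  have := h (monomial α 1)
  rw [apolar_monomial_right, apolar_monomial_right, one_mul, one_mul] at this
  refine mul_left_cancel₀ ?_ this
  exact Finset.prod_ne_zero_iff.mpr fun i _ => Nat.cast_ne_zero.mpr (Nat.factorial_ne_zero _)

lemma apolar_self_pos [LinearOrder S] [IsStrictOrderedRing S] {P : MvPolynomial σ S}
    (hP : P ≠ 0) : 0 < apolar P P := by
  rw [apolar_eq_sum]
  refine Finset.sum_pos (fun α hα => ?_) (support_nonempty.mpr hP)
  have h1 : 0 < coeff α P * coeff α P := mul_self_pos.mpr (mem_support_iff.mp hα)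
  have h2 : 0 < ∏ i, ((α i).factorial : S) :=
    Finset.prod_pos fun i _ => Nat.cast_pos.mpr (Nat.factorial_pos _)
  nlinarith [mul_pos h1 h2]

lemma exists_apolar_mul_eq (P G : MvPolynomial σ S) : ∃ Q, ∀ F, apolar P (G * F) = apolar Q F := by
  induction G using MvPolynomial.induction_on with
  | C c => exact ⟨C c * P, fun F => by rw [apolar_mul_C, apolar_C_mul]⟩
  | add G₁ G₂ h₁ h₂ =>
    obtain ⟨Q₁, h₁⟩ := h₁
    obtain ⟨Q₂, h₂⟩ := h₂
    exact ⟨Q₁ + Q₂, fun F => by simp [add_mul, h₁, h₂]⟩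
  | mul_X G i h =>
    obtain ⟨Q, h⟩ := h
    refine ⟨pderiv i Q, fun F => ?_⟩
    rw [mul_assoc, h, mul_comm, apolar_comm, apolar_mul_X, apolar_comm]

lemma apolar_map {S' : Type*} [CommRing S'] (φ : S →+* S') (P F : MvPolynomial σ S) :
    apolar (map φ P) (map φ F) = φ (apolar P F) := by
  induction P using MvPolynomial.induction_on' with
  | monomial α c => simp [apolar_monomial, coeff_map]
  | add P Q hP hQ => simp [hP, hQ]

end Apolar

variable [Fintype τ]

/-- The linear substitution of variables with matrix `A`. -/
noncomputable def linSubst (A : Matrix σ τ S) : MvPolynomial σ S →ₐ[S] MvPolynomial τ S :=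
  aeval fun i => ∑ j, C (A i j) * X j

@[simp]
lemma linSubst_X (A : Matrix σ τ S) (i : σ) : linSubst A (X i) = ∑ j, C (A i j) * X j := by
  simp [linSubst]

lemma pderiv_linSubst [Fintype σ] (A : Matrix σ τ S) (j : τ) (F : MvPolynomial σ S) :
    pderiv j (linSubst A F) = ∑ i, C (A i j) * linSubst A (pderiv i F) := by
  classical
  induction F using MvPolynomial.induction_on with
  | C c => simp [linSubst]
  | add F G hF hG => simp [hF, hG, mul_add, Finset.sum_add_distrib]
  | mul_X F k h =>
    have hX : pderiv j (linSubst A (X k)) = C (A k j) := by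
      simp [pderiv_X, Pi.single_apply, Derivation.leibniz]
    have hk : ∑ i, C (A i j) * linSubst A (pderiv i (X k)) = C (A k j) := by
      rw [Finset.sum_eq_single k] <;> simp +contextual [pderiv_X]
    rw [map_mul, pderiv_mul, h, hX, ← hk, Finset.mul_sum, Finset.sum_mul, ← Finset.sum_add_distrib]
    refine Finset.sum_congr rfl fun i _ => ?_
    rw [pderiv_mul, map_add, map_mul, map_mul]
    ring

/-- Linear substitutions with transposed matrices are adjoint. -/
lemma apolar_linSubst [Fintype σ] (A : Matrix σ τ S) (P : MvPolynomial σ S) (F : MvPolynomial τ S) :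
    apolar (linSubst A P) F = apolar P (linSubst A.transpose F) := by
  induction P using MvPolynomial.induction_on generalizing F with
  | C c =>
    have h : (constantCoeff : MvPolynomial σ S →+* S).comp
        (linSubst A.transpose : MvPolynomial τ S →ₐ[S] MvPolynomial σ S).toRingHom =
        constantCoeff := by
      ext <;> simp [linSubst]
    have h' : linSubst A (C c) = C c := by simp [linSubst]
    rw [h', apolar_C_left, apolar_C_left, ← h]
    rfl
  | add P Q hP hQ => rw [map_add, map_add, LinearMap.add_apply, hP, hQ, map_add,
      LinearMap.add_apply]
  | mul_X P i h =>
    rw [apolar_mul_X, pderiv_linSubst, map_mul, linSubst_X, Finset.mul_sum]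
    simp only [map_sum, LinearMap.sum_apply]
    refine Finset.sum_congr rfl fun j _ => ?_
    rw [mul_left_comm, apolar_C_mul, apolar_mul_X, h, apolar_mul_C, Matrix.transpose_apply]

lemma isHomogeneous_linSubst (A : Matrix σ τ S) {F : MvPolynomial σ S} {m : ℕ}
    (hF : F.IsHomogeneous m) : (linSubst A F).IsHomogeneous m := by
  have := hF.aeval (fun i => ∑ j, C (A i j) * X j) (n := 1) fun i =>
    IsHomogeneous.sum _ _ _ fun j _ => by
      simpa using (isHomogeneous_C τ (A i j)).mul (isHomogeneous_X S j)
  rwa [one_mul] at this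

end MvPolynomial

namespace MvPolynomial

open Matrix Kronecker

section GenericDet

variable (n : ℕ) (S : Type*) [CommRing S]

/-- The determinant of the generic `n × n` matrix. -/
noncomputable def genDet : MvPolynomial (Fin n × Fin n) S :=
  (mvPolynomialX (Fin n) (Fin n) S).det

lemma map_genDet {S' : Type*} [CommRing S'] (φ : S →+* S') :
    map φ (genDet n S) = genDet n S' := by
  rw [genDet, genDet, RingHom.map_det]
  congr 1
  ext i j : 2
  simp

lemma isHomogeneous_genDet : (genDet n S).IsHomogeneous n := by
  rw [genDet, det_apply]
  refine IsHomogeneous.sum _ _ _ fun σ _ => ?_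
  have h : (∏ i, mvPolynomialX (Fin n) (Fin n) S (σ i) i).IsHomogeneous n := by
    simpa using IsHomogeneous.prod Finset.univ
      (fun i => mvPolynomialX (Fin n) (Fin n) S (σ i) i) (fun _ => 1)
      fun i _ => by simpa using isHomogeneous_X S (σ i, i)
  rcases Int.units_eq_one_or (Equiv.Perm.sign σ) with hσ | hσ
  · simpa [hσ] using h
  · simpa [hσ] using h.neg

variable {n S}

lemma linSubst_one_kronecker {m l : Type*} [Fintype m] [DecidableEq m] [Fintype l]
    {k : Type*} (g : Matrix k l S) (i : m) (j : k) :
    linSubst ((1 : Matrix m m S) ⊗ₖ g) (X (i, j)) = ∑ a, C (g j a) * X (i, a) := by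
  rw [linSubst_X, Fintype.sum_prod_type, Finset.sum_eq_single i]
  · simp
  · intro b _ hb
    simp [Matrix.one_apply_ne hb.symm]
  · simp

lemma linSubst_genDet (g : Matrix (Fin n) (Fin n) S) :
    linSubst ((1 : Matrix (Fin n) (Fin n) S) ⊗ₖ g) (genDet n S) = C g.det * genDet n S := by
  have hC : C g.det = (g.map C : Matrix (Fin n) (Fin n) (MvPolynomial (Fin n × Fin n) S)).det :=
    RingHom.map_det C g
  rw [genDet, AlgHom.map_det, hC, ← det_transpose (g.map C), mul_comm, ← det_mul]
  congr 1
  ext i j : 2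
  rw [AlgHom.mapMatrix_apply, map_apply, mvPolynomialX_apply, linSubst_one_kronecker]
  simp [mul_apply, mul_comm]

/-- An identity of Cayley type: the operator `det(∂)` lowers the power of the determinant, up to
a scalar. -/
lemma apolar_genDet_pow_succ_mul (d : ℕ) (F : MvPolynomial (Fin n × Fin n) ℚ) :
    apolar (genDet n ℚ ^ d) (genDet n ℚ ^ d) *
        apolar (genDet n ℚ ^ (d + 1)) (genDet n ℚ * F) =
      apolar (genDet n ℚ ^ (d + 1)) (genDet n ℚ ^ (d + 1)) * apolar (genDet n ℚ ^ d) F := by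
  obtain ⟨Q, hQ⟩ := exists_apolar_mul_eq (genDet n ℚ ^ (d + 1)) (genDet n ℚ)
  have hD : genDet n ℚ ≠ 0 := det_mvPolynomialX_ne_zero _ _
  have hequi : ∀ g : Matrix (Fin n) (Fin n) ℚ,
      C g.det * linSubst ((1 : Matrix (Fin n) (Fin n) ℚ) ⊗ₖ gᵀ) Q = C (g.det ^ (d + 1)) * Q := by
    intro g
    refine eq_of_apolar_eq fun F => ?_
    have htr : ((1 : Matrix (Fin n) (Fin n) ℚ) ⊗ₖ gᵀ)ᵀ = (1 : Matrix (Fin n) (Fin n) ℚ) ⊗ₖ g := by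
      rw [← kroneckerMap_transpose, transpose_one, transpose_transpose]
    rw [apolar_C_mul, apolar_C_mul, apolar_linSubst, htr, ← hQ, ← apolar_mul_C, mul_left_comm,
      ← mul_assoc, mul_comm _ (C _), ← linSubst_genDet, ← map_mul, ← htr, ← apolar_linSubst,
      map_pow, linSubst_genDet, det_transpose, mul_pow, ← C_pow, apolar_C_mul, hQ]
  let q : ℚ := eval (fun p => (1 : Matrix (Fin n) (Fin n) ℚ) p.1 p.2) Q
  have hQq : Q = C q * genDet n ℚ ^ d := by
    refine mul_left_cancel₀ hD (MvPolynomial.funext fun x => ?_)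
    let g : Matrix (Fin n) (Fin n) ℚ := Matrix.of fun i j => x (i, j)
    have hdet : eval x (genDet n ℚ) = g.det := eval_det_mvPolynomialX _ _ x
    have hev : (eval fun p => (1 : Matrix (Fin n) (Fin n) ℚ) p.1 p.2).comp
        (linSubst ((1 : Matrix (Fin n) (Fin n) ℚ) ⊗ₖ gᵀ)).toRingHom = eval x := by
      refine ringHom_ext (fun r => by simp [linSubst]) fun ⟨i, j⟩ => ?_
      change eval _ (linSubst _ (X (i, j))) = _
      rw [linSubst_one_kronecker]
      simp [one_apply, g]
    have h := congrArg (eval fun p => (1 : Matrix (Fin n) (Fin n) ℚ) p.1 p.2) (hequi g)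
    rw [map_mul, map_mul, eval_C, eval_C] at h
    rw [map_mul, map_mul, map_mul, map_pow, hdet, eval_C, ← hev]
    refine h.trans ?_
    ring
  have hq : ∀ F, apolar (genDet n ℚ ^ (d + 1)) (genDet n ℚ * F) =
      q * apolar (genDet n ℚ ^ d) F := fun F => by rw [hQ, hQq, apolar_C_mul]
  have hself : apolar (genDet n ℚ ^ (d + 1)) (genDet n ℚ ^ (d + 1)) =
      q * apolar (genDet n ℚ ^ d) (genDet n ℚ ^ d) := by rw [← hq, ← pow_succ']
  rw [hq, hself]
  ring

lemma apolar_genDet_pow_pos (n d : ℕ) :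
    0 < apolar (genDet n ℚ ^ d) (genDet n ℚ ^ d) :=
  apolar_self_pos (pow_ne_zero _ (det_mvPolynomialX_ne_zero _ _))

variable [Algebra ℚ S]

variable (n S) in
/-- The linear functional on polynomials in the entries of a generic matrix which is given in
degree `n * d` by the normalised apolar product with the `d`-th power of the determinant. -/
noncomputable def omegaFunctional : MvPolynomial (Fin n × Fin n) S →ₗ[S] S :=
  (basisMonomials (Fin n × Fin n) S).constr S fun α =>
    algebraMap ℚ S (apolar (genDet n ℚ ^ (α.degree / n)) (genDet n ℚ ^ (α.degree / n)))⁻¹ *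
      apolar (genDet n S ^ (α.degree / n)) (monomial α 1)

lemma omegaFunctional_of_isHomogeneous {F : MvPolynomial (Fin n × Fin n) S} {m : ℕ}
    (hF : F.IsHomogeneous m) : omegaFunctional n S F =
      algebraMap ℚ S (apolar (genDet n ℚ ^ (m / n)) (genDet n ℚ ^ (m / n)))⁻¹ *
        apolar (genDet n S ^ (m / n)) F := by
  rw [F.as_sum, map_sum, map_sum, Finset.mul_sum]
  refine Finset.sum_congr rfl fun α hα => ?_
  have hdeg : α.degree = m := by
    rw [Finsupp.degree_eq_weight_one]
    exact hF (mem_support_iff.mp hα)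
  have h : monomial α (coeff α F) = coeff α F • basisMonomials (Fin n × Fin n) S α := by
    simp [smul_monomial]
  rw [h, map_smul, map_smul, omegaFunctional, Module.Basis.constr_basis, hdeg, coe_basisMonomials,
    smul_eq_mul, smul_eq_mul, mul_left_comm]

lemma omegaFunctional_one (n : ℕ) [NeZero n] : omegaFunctional n S 1 = 1 := by
  rw [omegaFunctional_of_isHomogeneous (isHomogeneous_one _ _), Nat.zero_div]
  rw [pow_zero, pow_zero, apolar_one_one, apolar_one_one, inv_one, map_one, one_mul]

lemma omegaFunctional_genDet_mul [NeZero n] (F : MvPolynomial (Fin n × Fin n) S) :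
    omegaFunctional n S (genDet n S * F) = omegaFunctional n S F := by
  suffices h : omegaFunctional n S ∘ₗ LinearMap.mulLeft S (genDet n S) = omegaFunctional n S from
    LinearMap.congr_fun h F
  refine (basisMonomials (Fin n × Fin n) S).ext fun α => ?_
  rw [LinearMap.comp_apply, LinearMap.mulLeft_apply, coe_basisMonomials]
  have hα : (monomial α (1 : S)).IsHomogeneous α.degree := isHomogeneous_monomial _ rfl
  rw [omegaFunctional_of_isHomogeneous ((isHomogeneous_genDet n S).mul hα),
    omegaFunctional_of_isHomogeneous hα,
    Nat.add_div_left _ (Nat.pos_of_ne_zero (NeZero.ne n))]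
  have hmap : monomial α (1 : S) = map (algebraMap ℚ S) (monomial α 1) := by simp
  rw [hmap, ← map_genDet n ℚ (algebraMap ℚ S), ← map_pow, ← map_pow, ← map_mul, apolar_map,
    apolar_map, ← map_mul, ← map_mul]
  congr 1
  have h := apolar_genDet_pow_succ_mul (n := n) (α.degree / n) (monomial α 1)
  have h0 := (apolar_genDet_pow_pos n (α.degree / n)).ne'
  have h1 := (apolar_genDet_pow_pos n (α.degree / n + 1)).ne'
  rw [inv_mul_eq_iff_eq_mul₀ h1, mul_left_comm, eq_inv_mul_iff_mul_eq₀ h0]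
  exact h

end GenericDet

end MvPolynomial

section Reynolds

open Matrix Kronecker

variable {K : Type*} [Field K] {n : ℕ}

/-- The action of the generic matrix `z` on `K[x_{ij}]`: the substitution
`x_{ij} ↦ ∑ a, z_{ia} x_{aj}`. -/
noncomputable def genericAct (K : Type*) [Field K] (n : ℕ) :
    MvPolynomial (Fin n × ℕ) K →ₐ[K]
      MvPolynomial (Fin n × Fin n) (MvPolynomial (Fin n × ℕ) K) :=
  aeval fun q => ∑ a, C (X (a, q.2)) * X (q.1, a)

lemma genericAct_dPoly (ι : Fin n → ℕ) :
    genericAct K n (dPoly K n ι) = C (dPoly K n ι) * genDet n _ := by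
  rw [dPoly, AlgHom.map_det, RingHom.map_det, mul_comm, genDet, ← det_mul]
  congr 1
  ext i j : 2
  simp [genericAct, mul_apply, mul_comm]

lemma dPoly_mem_detAlg (ι : Fin n → ℕ) : dPoly K n ι ∈ detAlg K n :=
  Algebra.subset_adjoin ⟨ι, rfl⟩

/-- Polynomials over `K[x_{ij}]` whose coefficients lie in `L_n`. -/
noncomputable def detCoeffs (K : Type*) [Field K] (n : ℕ) (τ : Type*) :
    Subsemiring (MvPolynomial τ (MvPolynomial (Fin n × ℕ) K)) :=
  (MvPolynomial.map (detAlg K n).val.toRingHom).rangeS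

lemma coeff_mem_of_mem_detCoeffs {τ : Type*} {P : MvPolynomial τ (MvPolynomial (Fin n × ℕ) K)}
    (hP : P ∈ detCoeffs K n τ) (α : τ →₀ ℕ) : coeff α P ∈ detAlg K n := by
  obtain ⟨P, rfl⟩ := hP
  rw [coeff_map]
  exact (coeff α P).2

lemma X_mem_detCoeffs {τ : Type*} (t : τ) : X t ∈ detCoeffs K n τ := ⟨X t, map_X _ _⟩

lemma C_mem_detCoeffs {τ : Type*} {f : MvPolynomial (Fin n × ℕ) K} (hf : f ∈ detAlg K n) :
    C f ∈ detCoeffs K n τ := ⟨C ⟨f, hf⟩, map_C _ _⟩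

/-- The generic `n × N` matrix times the transpose of the matrix of the first `N` columns of
`(x_{ij})` has determinant with coefficients in `L_n`. -/
lemma linSubst_genDet_mem_detCoeffs (N : ℕ) :
    linSubst ((1 : Matrix (Fin n) (Fin n) _) ⊗ₖ
        (Matrix.of fun (a : Fin n) (j : Fin N) => (X (a, (j : ℕ)) : MvPolynomial (Fin n × ℕ) K)))
      (genDet n _) ∈ detCoeffs K n (Fin n × Fin N) := by
  have hdet : linSubst ((1 : Matrix (Fin n) (Fin n) _) ⊗ₖ
        (Matrix.of fun (a : Fin n) (j : Fin N) => (X (a, (j : ℕ)) : MvPolynomial (Fin n × ℕ) K)))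
      (genDet n _) = detRowAlternating fun i => ∑ j : Fin N,
        (X (i, j) : MvPolynomial (Fin n × Fin N) (MvPolynomial (Fin n × ℕ) K)) •
          fun a => C (X (a, (j : ℕ))) := by
    rw [genDet, AlgHom.map_det]
    change det _ = det _
    congr 1
    ext i a : 2
    rw [AlgHom.mapMatrix_apply, map_apply, mvPolynomialX_apply, linSubst_one_kronecker]
    simp [mul_comm]
  rw [hdet, ← AlternatingMap.coe_multilinearMap, MultilinearMap.map_sum]
  refine sum_mem fun r _ => ?_
  rw [MultilinearMap.map_smul_univ]
  refine mul_mem (prod_mem fun i _ => X_mem_detCoeffs _) ?_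
  convert C_mem_detCoeffs (τ := Fin n × Fin N) (dPoly_mem_detAlg (K := K) fun i => (r i : ℕ))
  change det _ = _
  rw [dPoly, RingHom.map_det, ← det_transpose]
  congr 1

variable [CharZero K]

/-- The Reynolds operator, obtained by Cayley's Omega process. -/
noncomputable def reynolds (K : Type*) [Field K] [CharZero K] (n : ℕ) :
    MvPolynomial (Fin n × ℕ) K →ₗ[K] MvPolynomial (Fin n × ℕ) K :=
  ((omegaFunctional n (MvPolynomial (Fin n × ℕ) K)).restrictScalars K) ∘ₗ
    (genericAct K n).toLinearMap

lemma reynolds_apply (f : MvPolynomial (Fin n × ℕ) K) :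
    reynolds K n f = omegaFunctional n _ (genericAct K n f) := rfl

lemma reynolds_one [NeZero n] : reynolds K n 1 = 1 := by
  rw [reynolds_apply, map_one, omegaFunctional_one]

lemma reynolds_mul [NeZero n] {h : MvPolynomial (Fin n × ℕ) K} (hh : h ∈ detAlg K n)
    (f : MvPolynomial (Fin n × ℕ) K) : reynolds K n (h * f) = h * reynolds K n f := by
  induction hh using Algebra.adjoin_induction generalizing f with
  | mem x hx =>
    obtain ⟨ι, rfl⟩ := hx
    rw [reynolds_apply, map_mul, genericAct_dPoly, mul_assoc, ← smul_eq_C_mul, map_smul,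
      omegaFunctional_genDet_mul, smul_eq_mul, reynolds_apply]
  | algebraMap r => rw [← Algebra.smul_def, map_smul, Algebra.smul_def]
  | add x y _ _ hx hy => rw [add_mul, map_add, hx, hy, add_mul]
  | mul x y _ _ hx hy => rw [mul_assoc, hx, hy, mul_assoc]

lemma reynolds_rename_monomial_mem (N : ℕ) (α : Fin n × Fin N →₀ ℕ) (c : K) :
    reynolds K n (rename (Prod.map id Fin.val) (monomial α c)) ∈ detAlg K n := by
  let Y : Matrix (Fin n) (Fin N) (MvPolynomial (Fin n × ℕ) K) :=
    Matrix.of fun a j => X (a, (j : ℕ))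
  have hact : genericAct K n (rename (Prod.map id Fin.val) (monomial α c)) =
      linSubst ((1 : Matrix (Fin n) (Fin n) _) ⊗ₖ Yᵀ) (monomial α (C c)) := by
    have h : ((genericAct K n).toRingHom.comp (rename (Prod.map id Fin.val)).toRingHom) =
        (linSubst ((1 : Matrix (Fin n) (Fin n) _) ⊗ₖ Yᵀ)).toRingHom.comp
          (MvPolynomial.map C) := by
      refine ringHom_ext (fun r => ?_) fun ⟨i, j⟩ => ?_
      · simp [genericAct, linSubst]
      · change genericAct K n (rename _ (X (i, j))) = linSubst _ (MvPolynomial.map C (X (i, j)))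
        rw [map_X, linSubst_one_kronecker, rename_X]
        simp [genericAct, Y]
    rw [← map_monomial]
    exact RingHom.congr_fun h _
  have htr : ((1 : Matrix (Fin n) (Fin n) (MvPolynomial (Fin n × ℕ) K)) ⊗ₖ Y)ᵀ = 1 ⊗ₖ Yᵀ := by
    rw [← kroneckerMap_transpose, transpose_one]
  rw [reynolds_apply, hact, omegaFunctional_of_isHomogeneous
    (isHomogeneous_linSubst _ (isHomogeneous_monomial _ rfl)), ← htr, ← apolar_linSubst,
    apolar_monomial_right]
  have hQ : ∀ q : ℚ, algebraMap ℚ (MvPolynomial (Fin n × ℕ) K) q ∈ detAlg K n := fun q => by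
    rw [IsScalarTower.algebraMap_apply ℚ K]
    exact (detAlg K n).algebraMap_mem _
  refine mul_mem (hQ _) (mul_mem ((detAlg K n).algebraMap_mem c) (mul_mem ?_ ?_))
  · exact prod_mem fun i _ => natCast_mem _ _
  · refine coeff_mem_of_mem_detCoeffs ?_ _
    rw [map_pow]
    exact pow_mem (linSubst_genDet_mem_detCoeffs N) _

lemma reynolds_mem (f : MvPolynomial (Fin n × ℕ) K) : reynolds K n f ∈ detAlg K n := by
  induction f using MvPolynomial.induction_on' with
  | monomial β c =>
    let N := β.support.sup Prod.snd + 1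
    have hβ : ∀ q ∈ β.support, q.2 < N := fun q hq =>
      Nat.lt_succ_of_le (Finset.le_sup (f := Prod.snd) hq)
    have hinj : Function.Injective (Prod.map id Fin.val : Fin n × Fin N → Fin n × ℕ) :=
      Function.injective_id.prodMap Fin.val_injective
    have hrange : (β.support : Set (Fin n × ℕ)) ⊆
        Set.range (Prod.map id Fin.val : Fin n × Fin N → Fin n × ℕ) :=
      fun q hq => ⟨(q.1, ⟨q.2, hβ q hq⟩), rfl⟩
    rw [← Finsupp.mapDomain_comapDomain _ hinj β hrange, ← rename_monomial]
    exact reynolds_rename_monomial_mem N _ c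
  | add f g hf hg => rw [map_add]; exact add_mem hf hg

/-- Contracting the extension to `K[x_{ij}]` of an ideal of `L_n` gives back the ideal. -/
lemma mem_of_coe_mem_map_val [NeZero n] (I : Ideal (detAlg K n)) {h : detAlg K n}
    (hh : (h : MvPolynomial (Fin n × ℕ) K) ∈ I.map (detAlg K n).val) : h ∈ I := by
  have key : ∀ f ∈ I.map (detAlg K n).val, ∀ r : MvPolynomial (Fin n × ℕ) K,
      (⟨reynolds K n (r * f), reynolds_mem _⟩ : detAlg K n) ∈ I := by
    intro f hf
    induction hf using Submodule.span_induction with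
    | mem x hx =>
      obtain ⟨y, hy, rfl⟩ := hx
      intro r
      convert I.mul_mem_right ⟨reynolds K n r, reynolds_mem _⟩ hy using 1
      refine Subtype.ext ?_
      change reynolds K n (r * y) = y * reynolds K n r
      rw [mul_comm, reynolds_mul y.2]
    | zero =>
      intro r
      convert I.zero_mem
      simp
    | add x y _ _ hx hy =>
      intro r
      convert I.add_mem (hx r) (hy r) using 1
      refine Subtype.ext ?_
      change _ = reynolds K n (r * x) + reynolds K n (r * y)
      simp only [mul_add, map_add]
    | smul a x _ hx =>
      intro r
      simpa only [smul_eq_mul, mul_assoc] using hx (r * a)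
  convert key h hh 1
  rw [one_mul, ← mul_one (h : MvPolynomial (Fin n × ℕ) K), reynolds_mul h.2, reynolds_one]

end Reynolds

/-- Draisma, 2010. Over a field of characteristic `0`, every
`Sym(ℕ)`-invariant ideal of the determinantal subalgebra `L_n` is finitely generated as a
`Sym(ℕ)`-invariant ideal of `L_n`. -/
theorem detAlg_symInvariant_ideal_fg_of_charZero
    (K : Type) [Field K] [CharZero K] (n : ℕ) (hn : 1 ≤ n)
    (I : Ideal (detAlg K n))
    (hI : ∀ σ : Equiv.Perm ℕ, Ideal.map (colPermDet K n σ) I = I) :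
    ∃ B : Finset (detAlg K n), (↑B : Set (detAlg K n)) ⊆ I ∧
      I = Ideal.span {y | ∃ σ : Equiv.Perm ℕ, ∃ b ∈ B, y = colPermDet K n σ b} := by
  have : NeZero n := ⟨by omega⟩
  let J := I.map (detAlg K n).val
  have hJ : ∀ σ, ∀ f ∈ J, colPerm K n σ f ∈ J := by
    intro σ f hf
    induction hf using Submodule.span_induction with
    | mem x hx =>
      obtain ⟨y, hy, rfl⟩ := hx
      have hy' : colPermDet K n σ y ∈ I := hI σ ▸ Ideal.mem_map_of_mem _ hy
      exact Ideal.mem_map_of_mem (detAlg K n).val hy'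
    | zero => rw [map_zero]; exact zero_mem _
    | add x y _ _ hx hy => rw [map_add]; exact add_mem hx hy
    | smul a x _ hx => rw [smul_eq_mul, map_mul]; exact J.mul_mem_left _ hx
  obtain ⟨B', hB'J, hB'⟩ := exists_finset_le_span_colPerm J hJ
  have hfin : ∃ B : Finset (detAlg K n), (↑B : Set (detAlg K n)) ⊆ I ∧
      (B' : Set (MvPolynomial (Fin n × ℕ) K)) ⊆
        Ideal.span ((detAlg K n).val '' (B : Set (detAlg K n))) := by
    classical
    obtain ⟨T, hTI, hT⟩ := Submodule.subset_span_finite_of_subset_span hB'J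
    obtain ⟨B, hBI, rfl⟩ := Finset.subset_set_image_iff.mp hTI
    exact ⟨B, hBI, by simpa only [Finset.coe_image] using hT⟩
  obtain ⟨B, hBI, hB⟩ := hfin
  refine ⟨B, hBI, le_antisymm (fun h hh => ?_) (Ideal.span_le.mpr ?_)⟩
  · refine mem_of_coe_mem_map_val _ (?_ : (h : MvPolynomial (Fin n × ℕ) K) ∈ _)
    refine (hB'.trans (Ideal.span_le.mpr ?_)) (Ideal.mem_map_of_mem (detAlg K n).val hh)
    rintro _ ⟨σ, b, hb, rfl⟩
    have hb' := Ideal.mem_map_of_mem (colPerm K n σ) (hB hb)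
    rw [Ideal.map_span] at hb'
    refine Ideal.span_le.mpr ?_ hb'
    rintro _ ⟨_, ⟨y, hy, rfl⟩, rfl⟩
    have hmem : colPermDet K n σ y ∈
        Ideal.span {y | ∃ σ : Equiv.Perm ℕ, ∃ b ∈ B, y = colPermDet K n σ b} :=
      Ideal.subset_span ⟨σ, y, hy, rfl⟩
    exact Ideal.mem_map_of_mem (detAlg K n).val hmem
  · rintro _ ⟨σ, b, hb, rfl⟩
    exact hI σ ▸ Ideal.mem_map_of_mem _ (hBI hb)
end

section
/- Let K be a field of characteristic 2 and n = 2. Let I be the smallest Sym(ℕ)-invariant ideal of L_2 containing the set { d_{12}·d_{23}·⋯·d_{(k-1)k}·d_{1k} : k = 3, 4, … }. Then I is not finitely generated as a Sym(ℕ)-invariant ideal of L_2. -/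
open MvPolynomial

/-- `d_{ij}` for `n = 2`: the `2 × 2` determinant `x_{1i} x_{2j} - x_{1j} x_{2i}`. -/
noncomputable def d2 (K : Type*) [CommRing K] (i j : ℕ) : MvPolynomial (Fin 2 × ℕ) K :=
  dPoly K 2 ![i, j]

/-- The chain product `d_{12} d_{23} ⋯ d_{(k-1)k} d_{1k}` (for `k ≥ 3`). -/
noncomputable def chainProd (K : Type*) [CommRing K] (k : ℕ) : MvPolynomial (Fin 2 × ℕ) K :=
  (∏ j ∈ Finset.Icc 1 (k - 1), d2 K j (j + 1)) * d2 K 1 k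

lemma chainProd_mem_detAlg (K : Type*) [CommRing K] (k : ℕ) : chainProd K k ∈ detAlg K 2 :=
  mul_mem
    (prod_mem fun j _ => Algebra.subset_adjoin ⟨![j, j + 1], rfl⟩)
    (Algebra.subset_adjoin ⟨![1, k], rfl⟩)

/-- The chain product as an element of `L_2`. -/
noncomputable def chainProdL (K : Type*) [CommRing K] (k : ℕ) : detAlg K 2 :=
  ⟨chainProd K k, chainProd_mem_detAlg K k⟩

/-- The exponent in row `a` and column `i` of the leading monomial of the `k`-th chain product. -/
def leadExp (k : ℕ) (a : Fin 2) (i : ℕ) : ℕ :=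
  if i = 1 then (if a = 0 then 2 else 0) else if i = k then (if a = 0 then 0 else 2) else 1

/-- The leading monomial of the `k`-th chain product, restricted to the columns in `T`. -/
noncomputable def leadMon (k : ℕ) (T : Finset ℕ) : Fin 2 × ℕ →₀ ℕ :=
  ∑ i ∈ T, (Finsupp.single (0, i) (leadExp k 0 i) + Finsupp.single (1, i) (leadExp k 1 i))

lemma leadMon_apply (k : ℕ) (T : Finset ℕ) (a : Fin 2) (i : ℕ) :
    leadMon k T (a, i) = if i ∈ T then leadExp k a i else 0 := by
  fin_cases a <;>
    simp [leadMon, Finsupp.finsetSum_apply, Finsupp.single_apply, Finset.sum_ite_eq']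

lemma d2_eq (K : Type*) [CommRing K] (i j : ℕ) :
    d2 K i j = X (0, i) * X (1, j) - X (0, j) * X (1, i) := by
  simp [d2, dPoly, Matrix.det_fin_two]

lemma dPoly_two (K : Type*) [CommRing K] (ι : Fin 2 → ℕ) : dPoly K 2 ι = d2 K (ι 0) (ι 1) := by
  rw [d2]
  congr 1
  ext a
  fin_cases a <;> rfl

/-- Weight `1` on the first row and `-1` on the second row. -/
def rowBalance (q : Fin 2 × ℕ) : ℤ := if q.1 = 0 then 1 else -1

/-- The weight recording the column of a variable. -/
noncomputable def colWeight (q : Fin 2 × ℕ) : ℕ →₀ ℕ := Finsupp.single q.2 1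

lemma isWeightedHomogeneous_rowBalance {K : Type*} [CommRing K]
    {f : MvPolynomial (Fin 2 × ℕ) K} (hf : f ∈ detAlg K 2) :
    IsWeightedHomogeneous rowBalance f 0 := by
  induction hf using Algebra.adjoin_induction with
  | mem x hx =>
    obtain ⟨ι, rfl⟩ := hx
    rw [dPoly_two, d2_eq]
    have h (i j : ℕ) : IsWeightedHomogeneous rowBalance
        (X (0, i) * X (1, j) : MvPolynomial (Fin 2 × ℕ) K) 0 := by
      simpa [rowBalance] using (isWeightedHomogeneous_X K rowBalance ((0 : Fin 2), i)).mul
        (isWeightedHomogeneous_X K rowBalance ((1 : Fin 2), j))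
    exact Submodule.sub_mem (weightedHomogeneousSubmodule K rowBalance 0) (h _ _) (h _ _)
  | algebraMap r => exact isWeightedHomogeneous_C _ r
  | add x y _ _ hx hy => exact hx.add hy
  | mul x y _ _ hx hy => simpa using hx.mul hy

lemma isWeightedHomogeneous_colWeight_d2 (K : Type*) [CommRing K] (i j : ℕ) :
    IsWeightedHomogeneous colWeight (d2 K i j) (Finsupp.single i 1 + Finsupp.single j 1) := by
  rw [d2_eq]
  have h (i j : ℕ) : IsWeightedHomogeneous colWeight
      (X (0, i) * X (1, j) : MvPolynomial (Fin 2 × ℕ) K)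
      (Finsupp.single i 1 + Finsupp.single j 1) := by
    simpa [colWeight] using (isWeightedHomogeneous_X K colWeight ((0 : Fin 2), i)).mul
      (isWeightedHomogeneous_X K colWeight ((1 : Fin 2), j))
  refine Submodule.sub_mem (weightedHomogeneousSubmodule K colWeight _) (h _ _) ?_
  rw [add_comm]
  exact h _ _

lemma colPerm_chainProd (K : Type*) [CommRing K] (σ : Equiv.Perm ℕ) (k : ℕ) :
    colPerm K 2 σ (chainProd K k) =
      (∏ j ∈ Finset.Icc 1 (k - 1), d2 K (σ j) (σ (j + 1))) * d2 K (σ 1) (σ k) := by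
  simp only [chainProd, map_mul, map_prod, d2, colPerm_dPoly]
  simp [dPoly_two]

lemma sum_Icc_add_succ {M : Type*} [AddCommMonoid M] (f g : ℕ → M) (p : ℕ) :
    ∑ j ∈ Finset.Icc 1 (p + 1), (f j + g (j + 1)) =
      f 1 + ∑ j ∈ Finset.Icc 2 (p + 1), (f j + g j) + g (p + 2) := by
  induction p with
  | zero => simp
  | succ p ih =>
    rw [Finset.sum_Icc_succ_top (by omega), ih, Finset.sum_Icc_succ_top (a := 2) (b := p + 1) (by omega)]
    abel

lemma sum_Icc_one_eq {M : Type*} [AddCommMonoid M] (h : ℕ → M) (p : ℕ) :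
    ∑ j ∈ Finset.Icc 1 (p + 2), h j = h 1 + ∑ j ∈ Finset.Icc 2 (p + 1), h j + h (p + 2) := by
  rw [Finset.sum_Icc_succ_top (by omega), ← Finset.add_sum_Ioc_eq_sum_Icc (by omega)]
  rfl

lemma isWeightedHomogeneous_colWeight_colPerm_chainProd (K : Type*) [CommRing K]
    (σ : Equiv.Perm ℕ) (k : ℕ) (hk : 3 ≤ k) :
    IsWeightedHomogeneous colWeight (colPerm K 2 σ (chainProd K k))
      (∑ i ∈ (Finset.Icc 1 k).image σ, Finsupp.single i 2) := by
  obtain ⟨p, rfl⟩ : ∃ p, k = p + 2 := ⟨k - 2, by omega⟩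
  rw [colPerm_chainProd, Finset.sum_image σ.injective.injOn]
  convert (IsWeightedHomogeneous.prod (Finset.Icc 1 (p + 2 - 1)) _ _ fun j _ =>
    isWeightedHomogeneous_colWeight_d2 K (σ j) (σ (j + 1))).mul
      (isWeightedHomogeneous_colWeight_d2 K (σ 1) (σ (p + 2))) using 1
  have h2 (i : ℕ) : Finsupp.single (σ i) 2 = Finsupp.single (σ i) 1 + Finsupp.single (σ i) 1 := by
    rw [← Finsupp.single_add]
  rw [show p + 2 - 1 = p + 1 by omega, sum_Icc_add_succ (fun j => Finsupp.single (σ j) 1)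
    (fun j => Finsupp.single (σ j) 1), sum_Icc_one_eq]
  simp only [h2]
  abel

lemma weight_colWeight_apply (s : Fin 2 × ℕ →₀ ℕ) (i : ℕ) :
    Finsupp.weight colWeight s i = s (0, i) + s (1, i) := by
  induction s using Finsupp.induction_linear with
  | zero => simp
  | add f g hf hg => simp [hf, hg]; abel
  | single q n =>
    obtain ⟨a, j⟩ := q
    fin_cases a <;> simp [colWeight, Finsupp.weight_single, Finsupp.single_apply]

lemma weight_rowBalance_leadMon (k : ℕ) (hk : 1 < k) (T : Finset ℕ) :
    Finsupp.weight rowBalance (leadMon k T) =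
      (if 1 ∈ T then 2 else 0) - (if k ∈ T then 2 else 0) := by
  have h (i : ℕ) : (leadExp k 0 i : ℤ) + -(leadExp k 1 i : ℤ) =
      (if i = 1 then 2 else 0) - (if i = k then 2 else 0) := by
    simp only [leadExp]
    split_ifs <;> simp_all
  simp [leadMon, map_sum, Finsupp.weight_single, rowBalance, h, Finset.sum_sub_distrib]

/-- The polarization derivation, sending the second row to the first and killing the first. -/
noncomputable def rowDer (K : Type*) [CommRing K] :
    Derivation K (MvPolynomial (Fin 2 × ℕ) K) (MvPolynomial (Fin 2 × ℕ) K) :=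
  mkDerivation K fun q => if q.1 = 1 then X (0, q.2) else 0

lemma rowDer_eq_zero {K : Type*} [CommRing K] {f : MvPolynomial (Fin 2 × ℕ) K}
    (hf : f ∈ detAlg K 2) : rowDer K f = 0 := by
  induction hf using Algebra.adjoin_induction with
  | mem x hx =>
    obtain ⟨ι, rfl⟩ := hx
    simp [dPoly_two, d2_eq, rowDer, mkDerivation_X]
    ring
  | algebraMap r => simp
  | add x y _ _ hx hy => simp [hx, hy]
  | mul x y _ _ hx hy => simp [hx, hy]

lemma coeff_rowDer {K : Type*} [CommRing K] [CharP K 2] (A : Fin 2 × ℕ →₀ ℕ) (t : ℕ)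
    (ht : A (0, t) = 0 ∧ A (1, t) = 0)
    (hA : ∀ i, A (0, i) = A (1, i) ∧ A (1, i) ≤ 1) (f : MvPolynomial (Fin 2 × ℕ) K) :
    coeff (A + Finsupp.single (0, t) 2) (rowDer K f) =
      coeff (A + (Finsupp.single (0, t) 1 + Finsupp.single (1, t) 1)) f := by
  induction f using MvPolynomial.induction_on' with
  | add p q hp hq => simp [hp, hq]
  | monomial s r =>
    have hq (i : ℕ) (h : s - Finsupp.single (1, i) 1 + Finsupp.single (0, i) 1 =
        A + Finsupp.single (0, t) 2) (h2 : (s (1, i) : K) ≠ 0) :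
        i = t ∧ s = A + (Finsupp.single (0, t) 1 + Finsupp.single (1, t) 1) := by
      have h3 : s (1, i) ≠ 0 := fun h => h2 (by simp [h])
      have hs (q : Fin 2 × ℕ) := DFunLike.congr_fun h q
      simp only [Finsupp.add_apply, Finsupp.tsub_apply, Finsupp.single_apply] at hs
      have hi : i = t := by
        by_contra hne
        have e0 := hs (0, i)
        have e1 := hs (1, i)
        simp [Ne.symm hne] at e0 e1
        have := hA i
        exact h2 (by rw [show s (1, i) = 2 by omega]; exact_mod_cast CharTwo.two_eq_zero)
      subst hi
      refine ⟨rfl, ?_⟩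
      ext ⟨a, l⟩
      have e := hs (a, l)
      have e1 := hs (1, i)
      by_cases hl : i = l
      · subst hl
        fin_cases a <;> simp at e e1 ⊢ <;> omega
      · simpa [hl] using e
    have hterm (n : Fin 2 × ℕ →₀ ℕ) (i : ℕ) (c : K) :
        coeff (A + Finsupp.single (0, t) 2)
          (monomial n c • X (0, i) : MvPolynomial (Fin 2 × ℕ) K) =
        if n + Finsupp.single (0, i) 1 = A + Finsupp.single (0, t) 2 then c else 0 := by
      rw [smul_eq_mul, X, monomial_mul, mul_one, coeff_monomial]
    rw [rowDer, mkDerivation_monomial, coeff_smul, Finsupp.sum, coeff_sum,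
      Finset.sum_eq_single (1, t)]
    · rw [if_pos rfl, hterm, coeff_monomial]
      by_cases hs : s = A + (Finsupp.single (0, t) 1 + Finsupp.single (1, t) 1)
      · have hM : s - Finsupp.single (1, t) 1 + Finsupp.single (0, t) 1 =
            A + Finsupp.single (0, t) 2 := by
          rw [hs, ← add_assoc, add_tsub_cancel_right, add_assoc, ← Finsupp.single_add]
        rw [if_pos hM, if_pos hs, hs]
        simp [ht]
      · rw [if_neg hs]
        by_cases h2 : (s (1, t) : K) = 0
        · simp [h2]
        · rw [if_neg fun h => hs (hq t h h2).2, smul_zero]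
    · rintro ⟨a, i⟩ _ hne
      fin_cases a
      · simp
      · simp only [Fin.mk_one, if_true] at hne ⊢
        rw [hterm]
        by_cases h2 : (s (1, i) : K) = 0
        · simp [h2]
        · exact if_neg fun h => hne (by rw [(hq i h h2).1])
    · intro h
      simp [Finsupp.notMem_support_iff.1 h]

lemma coeff_leadMon_of_notMem {K : Type*} [CommRing K] [CharP K 2] (k : ℕ) (T : Finset ℕ)
    (hT : T.Nonempty) (h1 : 1 ∉ T) (hk : k ∉ T) {f : MvPolynomial (Fin 2 × ℕ) K}
    (hf : f ∈ detAlg K 2) : coeff (leadMon k T) f = 0 := by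
  obtain ⟨t, ht⟩ := hT
  have key := coeff_rowDer (leadMon k (T.erase t)) t (by simp [leadMon_apply])
    (fun i => by
      simp only [leadMon_apply, leadExp]
      split_ifs <;> simp_all) f
  rw [rowDer_eq_zero hf, coeff_zero] at key
  rw [key]
  congr 1
  have h1t : t ≠ 1 := fun h => h1 (h ▸ ht)
  have hkt : t ≠ k := fun h => hk (h ▸ ht)
  rw [leadMon, ← Finset.sum_erase_add _ _ ht]
  simp [leadMon, leadExp, h1t, hkt]

lemma coeff_leadMon_eq_zero {K : Type*} [CommRing K] [CharP K 2] (k : ℕ) (hk : 1 < k)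
    (T : Finset ℕ) (hT : T.Nonempty) (h1k : ¬ (1 ∈ T ∧ k ∈ T))
    {f : MvPolynomial (Fin 2 × ℕ) K} (hf : f ∈ detAlg K 2) : coeff (leadMon k T) f = 0 := by
  by_contra h
  have hb := isWeightedHomogeneous_rowBalance hf h
  rw [weight_rowBalance_leadMon k hk] at hb
  by_cases h1 : 1 ∈ T <;> by_cases h2 : k ∈ T
  · exact h1k ⟨h1, h2⟩
  · simp [h1, h2] at hb
  · simp [h1, h2] at hb
  · exact h (coeff_leadMon_of_notMem k T hT h1 h2 hf)

lemma leadExp_add (k i : ℕ) : leadExp k 0 i + leadExp k 1 i = 2 := by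
  simp only [leadExp]
  split_ifs <;> simp_all

lemma coeff_mul_colPerm_chainProd {K : Type*} [CommRing K] [CharP K 2] {j k : ℕ} (hj : 3 ≤ j)
    (hjk : j < k) (σ : Equiv.Perm ℕ) {f : MvPolynomial (Fin 2 × ℕ) K} (hf : f ∈ detAlg K 2) :
    coeff (leadMon k (Finset.Icc 1 k)) (f * colPerm K 2 σ (chainProd K j)) = 0 := by
  classical
  rw [coeff_mul]
  refine Finset.sum_eq_zero fun ⟨u, v⟩ huv => ?_
  rw [Finset.HasAntidiagonal.mem_antidiagonal] at huv
  by_contra hne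
  dsimp only at hne huv
  have hv := right_ne_zero_of_mul hne
  set S := (Finset.Icc 1 j).image σ with hS
  have hw := isWeightedHomogeneous_colWeight_colPerm_chainProd K σ j hj hv
  have hcol (i : ℕ) : v (0, i) + v (1, i) = if i ∈ S then 2 else 0 := by
    rw [← weight_colWeight_apply, hw]
    simp [Finsupp.finsetSum_apply, Finsupp.single_apply, Finset.sum_ite_eq', ← hS]
  have hadd (a : Fin 2) (i : ℕ) :
      u (a, i) + v (a, i) = if i ∈ Finset.Icc 1 k then leadExp k a i else 0 := by
    rw [← leadMon_apply, ← huv, Finsupp.add_apply]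
  have hsub : S ⊆ Finset.Icc 1 k := by
    intro i hi
    by_contra hik
    have h0 := hadd 0 i
    have h1 := hadd 1 i
    have h2 := hcol i
    rw [if_neg hik] at h0 h1
    rw [if_pos hi] at h2
    omega
  have hvS : v = leadMon k S := by
    ext ⟨a, i⟩
    rw [leadMon_apply]
    have h0 := hadd 0 i
    have h1 := hadd 1 i
    have h2 := hcol i
    have h3 := leadExp_add k i
    by_cases hi : i ∈ S
    · rw [if_pos (hsub hi)] at h0 h1
      rw [if_pos hi] at h2 ⊢
      fin_cases a <;> simp <;> omega
    · rw [if_neg hi] at h2 ⊢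
      fin_cases a <;> simp <;> omega
  have huS : u = leadMon k (Finset.Icc 1 k \ S) := by
    ext ⟨a, i⟩
    have h0 := hadd a i
    rw [hvS, leadMon_apply] at h0
    simp only [leadMon_apply, Finset.mem_sdiff]
    by_cases hi : i ∈ S
    · rw [if_pos (hsub hi), if_pos hi] at h0
      simp [hi]
      omega
    · simpa [hi] using h0
  by_cases h1k : 1 ∈ S ∧ k ∈ S
  · refine left_ne_zero_of_mul hne ?_
    rw [huS]
    refine coeff_leadMon_eq_zero k (by omega) _ ?_ (by simp [h1k]) hf
    rw [Finset.sdiff_nonempty]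
    intro h
    have := Finset.card_le_card h
    rw [hS, Finset.card_image_of_injective _ σ.injective] at this
    simp at this
    omega
  · refine hv ?_
    rw [hvS]
    refine coeff_leadMon_eq_zero k (by omega) _ ?_ h1k
      (colPerm_mem_detAlg K 2 σ (chainProd_mem_detAlg K j))
    exact ⟨σ 1, Finset.mem_image_of_mem _ (by simp; omega)⟩

/-- `a` is the unique monomial of maximal `w`-weight in `f`, and it has coefficient one. -/
def HasLeadMon {τ K : Type*} [CommSemiring K] (w : τ → ℕ) (f : MvPolynomial τ K) (a : τ →₀ ℕ) :
    Prop :=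
  coeff a f = 1 ∧ ∀ s, coeff s f ≠ 0 → s = a ∨ Finsupp.weight w s < Finsupp.weight w a

lemma HasLeadMon.mul {τ K : Type*} [CommSemiring K] {w : τ → ℕ} {f g : MvPolynomial τ K}
    {a b : τ →₀ ℕ} (hf : HasLeadMon w f a) (hg : HasLeadMon w g b) :
    HasLeadMon w (f * g) (a + b) := by
  classical
  have key (s t : τ →₀ ℕ) (h : coeff s f * coeff t g ≠ 0) :
      (s = a ∧ t = b) ∨ Finsupp.weight w (s + t) < Finsupp.weight w (a + b) := by
    rw [map_add, map_add]
    rcases hf.2 s (left_ne_zero_of_mul h) with rfl | hs <;>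
      rcases hg.2 t (right_ne_zero_of_mul h) with rfl | ht
    · exact Or.inl ⟨rfl, rfl⟩
    all_goals right; omega
  constructor
  · rw [coeff_mul, Finset.sum_eq_single (a, b)]
    · simp [hf.1, hg.1]
    · rintro ⟨s, t⟩ hst hne
      rw [Finset.HasAntidiagonal.mem_antidiagonal] at hst
      by_contra h
      rcases key s t h with ⟨rfl, rfl⟩ | h
      · exact hne rfl
      · dsimp only at hst
        rw [hst] at h
        exact lt_irrefl _ h
    · simp
  · intro s hs
    rw [coeff_mul] at hs
    obtain ⟨⟨x, y⟩, hxy, hne⟩ := Finset.exists_ne_zero_of_sum_ne_zero hs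
    rw [Finset.HasAntidiagonal.mem_antidiagonal] at hxy
    dsimp only at hxy hne
    rcases key x y hne with ⟨rfl, rfl⟩ | h
    · exact Or.inl hxy.symm
    · exact Or.inr (hxy ▸ h)

lemma HasLeadMon.prod {τ K ι : Type*} [CommSemiring K] {w : τ → ℕ} {f : ι → MvPolynomial τ K}
    {a : ι → τ →₀ ℕ} (T : Finset ι) (h : ∀ i ∈ T, HasLeadMon w (f i) (a i)) :
    HasLeadMon w (∏ i ∈ T, f i) (∑ i ∈ T, a i) := by
  classical
  induction T using Finset.induction_on with
  | empty =>
    refine ⟨by simp, fun s hs => Or.inl ?_⟩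
    by_contra h
    rw [Finset.sum_empty] at h
    exact hs (by simp [coeff_one, Ne.symm h])
  | insert i T hi ih =>
    rw [Finset.prod_insert hi, Finset.sum_insert hi]
    exact (h i (by simp)).mul (ih fun j hj => h j (by simp [hj]))

lemma hasLeadMon_d2 (K : Type*) [CommRing K] {i j : ℕ} (hij : i < j) :
    HasLeadMon (fun q : Fin 2 × ℕ => if q.1 = 1 then q.2 else 0) (d2 K i j)
      (Finsupp.single (0, i) 1 + Finsupp.single (1, j) 1) := by
  classical
  have hX (a b : ℕ) : (X (0, a) * X (1, b) : MvPolynomial (Fin 2 × ℕ) K) =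
      monomial (Finsupp.single (0, a) 1 + Finsupp.single (1, b) 1) 1 := by
    simp [X, monomial_mul]
  have hne : (Finsupp.single ((0 : Fin 2), j) 1 + Finsupp.single ((1 : Fin 2), i) 1 :
      Fin 2 × ℕ →₀ ℕ) ≠ Finsupp.single (0, i) 1 + Finsupp.single (1, j) 1 := by
    intro h
    have := DFunLike.congr_fun h ((0 : Fin 2), j)
    simp [hij.ne] at this
  rw [d2_eq, hX, hX]
  refine ⟨by simp [coeff_monomial, hne], fun s hs => ?_⟩
  by_contra! h
  obtain ⟨h1, h2⟩ := h
  rw [coeff_sub, coeff_monomial, coeff_monomial, if_neg (Ne.symm h1)] at hs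
  by_cases h3 : Finsupp.single (0, j) 1 + Finsupp.single (1, i) 1 = s
  · subst h3
    simp [Finsupp.weight_single] at h2
    omega
  · simp [h3] at hs

lemma coeff_chainProd (K : Type*) [CommRing K] {k : ℕ} (hk : 3 ≤ k) :
    coeff (leadMon k (Finset.Icc 1 k)) (chainProd K k) = 1 := by
  have h := (HasLeadMon.prod (Finset.Icc 1 (k - 1)) fun j _ =>
    hasLeadMon_d2 K (Nat.lt_succ_self j)).mul (hasLeadMon_d2 K (show 1 < k by omega))
  rw [chainProd, ← h.1]
  congr 1
  obtain ⟨p, rfl⟩ : ∃ p, k = p + 2 := ⟨k - 2, by omega⟩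
  have hmid : ∀ i ∈ Finset.Icc 2 (p + 1),
      (Finsupp.single ((0 : Fin 2), i) (leadExp (p + 2) 0 i) +
        Finsupp.single ((1 : Fin 2), i) (leadExp (p + 2) 1 i) : Fin 2 × ℕ →₀ ℕ) =
      Finsupp.single (0, i) 1 + Finsupp.single (1, i) 1 := by
    intro i hi
    rw [Finset.mem_Icc] at hi
    simp [leadExp, show i ≠ 1 by omega, show i ≠ p + 2 by omega]
  have h2 (q : Fin 2 × ℕ) : Finsupp.single q 2 = Finsupp.single q 1 + Finsupp.single q 1 := by
    rw [← Finsupp.single_add]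
  rw [leadMon, sum_Icc_one_eq, Finset.sum_congr rfl hmid, show p + 2 - 1 = p + 1 by omega,
    sum_Icc_add_succ (fun j => Finsupp.single ((0 : Fin 2), j) 1)
    (fun j => Finsupp.single ((1 : Fin 2), j) 1)]
  simp [leadExp, h2]
  abel

lemma colPermDet_colPermDet (K : Type*) [CommRing K] (n : ℕ) (σ τ : Equiv.Perm ℕ)
    (x : detAlg K n) : colPermDet K n τ (colPermDet K n σ x) = colPermDet K n (σ.trans τ) x := by
  apply Subtype.ext
  change colPerm K n τ (colPerm K n σ x) = colPerm K n (σ.trans τ) x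
  simp only [colPerm, rename_rename]
  rfl

/-- The invariant ideal generated by the chain products of length at most `N`. -/
noncomputable def chainIdeal (K : Type*) [CommRing K] (N : ℕ) : Ideal (detAlg K 2) :=
  Ideal.span {y | ∃ σ : Equiv.Perm ℕ, ∃ k, 3 ≤ k ∧ k ≤ N ∧ y = colPermDet K 2 σ (chainProdL K k)}

lemma chainIdeal_mono (K : Type*) [CommRing K] : Monotone (chainIdeal K) := by
  intro N M h
  apply Ideal.span_mono
  rintro _ ⟨σ, k, h3, hk, rfl⟩
  exact ⟨σ, k, h3, hk.trans h, rfl⟩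

lemma colPermDet_mem_chainIdeal {K : Type*} [CommRing K] {N : ℕ} (τ : Equiv.Perm ℕ)
    {x : detAlg K 2} (hx : x ∈ chainIdeal K N) : colPermDet K 2 τ x ∈ chainIdeal K N := by
  have h : chainIdeal K N ≤ (chainIdeal K N).comap (colPermDet K 2 τ) := by
    refine Ideal.span_le.2 ?_
    rintro _ ⟨σ, k, h3, hk, rfl⟩
    exact Ideal.subset_span ⟨σ.trans τ, k, h3, hk, colPermDet_colPermDet K 2 σ τ _⟩
  exact h hx

lemma exists_mem_chainIdeal {K : Type*} [CommRing K] {x : detAlg K 2}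
    (hx : x ∈ Ideal.span {y | ∃ σ : Equiv.Perm ℕ, ∃ k, 3 ≤ k ∧
      y = colPermDet K 2 σ (chainProdL K k)}) : ∃ N, x ∈ chainIdeal K N := by
  induction hx using Submodule.span_induction with
  | mem x h =>
    obtain ⟨σ, k, hk, rfl⟩ := h
    exact ⟨k, Ideal.subset_span ⟨σ, k, hk, le_rfl, rfl⟩⟩
  | zero => exact ⟨0, zero_mem _⟩
  | add x y _ _ hx hy =>
    obtain ⟨N, hN⟩ := hx
    obtain ⟨M, hM⟩ := hy
    exact ⟨max N M, add_mem (chainIdeal_mono K (le_max_left _ _) hN)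
      (chainIdeal_mono K (le_max_right _ _) hM)⟩
  | smul a x _ hx =>
    obtain ⟨N, hN⟩ := hx
    exact ⟨N, Ideal.mul_mem_left _ a hN⟩

lemma coeff_eq_zero_of_mem_chainIdeal {K : Type*} [CommRing K] [CharP K 2] {N k : ℕ} (hk : N < k)
    {x : detAlg K 2} (hx : x ∈ chainIdeal K N) (a : detAlg K 2) :
    coeff (leadMon k (Finset.Icc 1 k)) ((a * x : detAlg K 2) : MvPolynomial (Fin 2 × ℕ) K) = 0 := by
  induction hx using Submodule.span_induction generalizing a with
  | mem x h =>
    obtain ⟨σ, j, h3, hj, rfl⟩ := h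
    exact coeff_mul_colPerm_chainProd h3 (hj.trans_lt hk) σ a.2
  | zero => simp
  | add x y _ _ hx hy =>
    have hx' := hx a
    have hy' := hy a
    rw [mul_add]
    simp_all
  | smul b x _ hx =>
    rw [smul_eq_mul, ← mul_assoc]
    exact hx (a * b)

/-- Domokos–Krasilnikov, 2013. Over a field `K` of characteristic `2`, the
smallest `Sym(ℕ)`-invariant ideal of `L_2` containing the set
`{ d_{12} d_{23} ⋯ d_{(k-1)k} d_{1k} : k = 3, 4, … }` is not finitely generated as a
`Sym(ℕ)`-invariant ideal of `L_2`. -/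
theorem chainProd_ideal_not_fg
    (K : Type) [Field K] [CharP K 2] :
    ¬ ∃ B : Finset (detAlg K 2),
        (↑B : Set (detAlg K 2)) ⊆
          (Ideal.span {y | ∃ σ : Equiv.Perm ℕ, ∃ k, 3 ≤ k ∧ y = colPermDet K 2 σ (chainProdL K k)} :
            Ideal (detAlg K 2)) ∧
        Ideal.span {y | ∃ σ : Equiv.Perm ℕ, ∃ k, 3 ≤ k ∧ y = colPermDet K 2 σ (chainProdL K k)} =
          Ideal.span {y | ∃ σ : Equiv.Perm ℕ, ∃ b ∈ B, y = colPermDet K 2 σ b} := by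
  rintro ⟨B, hB, hspan⟩
  have hex : ∀ b : detAlg K 2, ∃ N, b ∈ B → b ∈ chainIdeal K N := by
    intro b
    by_cases hb : b ∈ B
    · obtain ⟨N, hN⟩ := exists_mem_chainIdeal (hB hb)
      exact ⟨N, fun _ => hN⟩
    · exact ⟨0, fun h => absurd h hb⟩
  choose N hN using hex
  set M := B.sup N
  have hle : Ideal.span {y | ∃ σ : Equiv.Perm ℕ, ∃ b ∈ B, y = colPermDet K 2 σ b} ≤
      chainIdeal K M := by
    refine Ideal.span_le.2 ?_
    rintro _ ⟨σ, b, hb, rfl⟩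
    exact colPermDet_mem_chainIdeal σ (chainIdeal_mono K (Finset.le_sup hb) (hN b hb))
  have hmem : colPermDet K 2 1 (chainProdL K (M + 3)) ∈ chainIdeal K M := by
    apply hle
    rw [← hspan]
    exact Ideal.subset_span ⟨1, M + 3, by omega, rfl⟩
  have h0 := coeff_eq_zero_of_mem_chainIdeal (show M < M + 3 by omega) hmem 1
  rw [one_mul] at h0
  have h1 : ((colPermDet K 2 1 (chainProdL K (M + 3)) : detAlg K 2) :
      MvPolynomial (Fin 2 × ℕ) K) = chainProd K (M + 3) := by
    change colPerm K 2 1 (chainProd K (M + 3)) = _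
    rw [colPerm_chainProd]
    rfl
  rw [h1, coeff_chainProd K (by omega)] at h0
  exact one_ne_zero h0
end

section
/- Let K be a field of characteristic p with 0 < p ≤ n. Then the symmetric subalgebra R̄_n contains a Sym(ℕ)-invariant ideal that is not finitely generated as a Sym(ℕ)-invariant ideal of R̄_n. -/
open MvPolynomial

/-- The substitution sending `x_{ij}` to `t_j` when `i < p` and `j ≠ 0`, and to `0` otherwise. -/
noncomputable def rowCollapse (K : Type*) [CommSemiring K] (n p : ℕ) :
    MvPolynomial (Fin n × ℕ) K →ₐ[K] MvPolynomial ℕ K :=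
  aeval fun q => if (q.1 : ℕ) < p ∧ q.2 ≠ 0 then X q.2 else 0

lemma rowCollapse_X (K : Type*) [CommSemiring K] (n p : ℕ) (i : Fin n) (j : ℕ) :
    rowCollapse K n p (X (i, j)) = if (i : ℕ) < p ∧ j ≠ 0 then X j else 0 := by
  simp [rowCollapse]

lemma pderiv_rowCollapse (K : Type*) [CommSemiring K] (n p j : ℕ)
    (f : MvPolynomial (Fin n × ℕ) K) :
    pderiv j (rowCollapse K n p f) = ∑ i : Fin n,
      rowCollapse K n p (pderiv (i, j) f) * pderiv j (rowCollapse K n p (X (i, j))) := by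
  induction f using MvPolynomial.induction_on with
  | C a => simp [rowCollapse]
  | add f g hf hg => simp only [map_add, hf, hg, add_mul, Finset.sum_add_distrib]
  | mul_X f q hf =>
    obtain ⟨i₀, j₀⟩ := q
    have hX (i : Fin n) :
        rowCollapse K n p (pderiv (i, j) (X (i₀, j₀))) *
            pderiv j (rowCollapse K n p (X (i, j))) =
          if i = i₀ then pderiv j (rowCollapse K n p (X (i₀, j₀))) else 0 := by
      by_cases hi : i = i₀
      · by_cases hj : j = j₀
        · simp [hi, hj]
        · rw [pderiv_X_of_ne fun h => hj (Prod.ext_iff.1 h).2.symm, rowCollapse_X, rowCollapse_X]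
          split_ifs <;> simp [pderiv_X_of_ne (R := K) (Ne.symm hj)]
      · rw [pderiv_X_of_ne fun h => hi (Prod.ext_iff.1 h).1.symm]
        simp [hi]
    simp only [map_mul, map_add, pderiv_mul, add_mul, Finset.sum_add_distrib, mul_assoc, hX]
    rw [← Finset.mul_sum, Finset.sum_ite_eq' Finset.univ i₀, if_pos (Finset.mem_univ _), hf,
      Finset.sum_mul]
    simp only [mul_assoc, mul_comm (rowCollapse K n p (X (i₀, j₀)))]

lemma rowCollapse_rowPerm_swap (K : Type*) [CommSemiring K] {n p : ℕ} {i i' : Fin n}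
    (hi : (i : ℕ) < p) (hi' : (i' : ℕ) < p) (f : MvPolynomial (Fin n × ℕ) K) :
    rowCollapse K n p (rowPerm K n (Equiv.swap i i') f) = rowCollapse K n p f := by
  rw [rowCollapse, rowPerm, aeval_rename]
  congr 2
  funext q
  have : ((Equiv.swap i i' q.1 : Fin n) : ℕ) < p ↔ (q.1 : ℕ) < p := by
    rw [Equiv.swap_apply_def]
    split_ifs <;> simp_all
  simp [this]

lemma rowCollapse_pderiv_eq {K : Type*} [CommSemiring K] {n p : ℕ} {i i' : Fin n}
    (hi : (i : ℕ) < p) (hi' : (i' : ℕ) < p) (j : ℕ) {f : MvPolynomial (Fin n × ℕ) K}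
    (hf : f ∈ symAlg K n) :
    rowCollapse K n p (pderiv (i, j) f) = rowCollapse K n p (pderiv (i', j) f) := by
  rw [← rowCollapse_rowPerm_swap K hi hi' (pderiv (i, j) f)]
  congr 1
  have hinj : Function.Injective
      (fun q : Fin n × ℕ => (Equiv.swap i i' q.1, q.2)) := fun a b h => by
    simpa [Prod.ext_iff] using h
  have h := pderiv_rename (R := K) hinj (i, j) f
  simp only [Equiv.swap_apply_left] at h
  rw [rowPerm, ← h]
  exact congrArg _ (hf (Equiv.swap i i'))

lemma sum_ite_val_lt {M : Type*} [AddCommMonoid M] {n p : ℕ} (hpn : p ≤ n) (c : M) :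
    (∑ i : Fin n, if (i : ℕ) < p then c else 0) = p • c := by
  rw [Fin.sum_univ_eq_sum_range (fun i => if i < p then c else 0) n, ← Finset.sum_filter,
    Finset.sum_const]
  congr 1
  have : (Finset.range n).filter (· < p) = Finset.range p := by
    ext i
    simp only [Finset.mem_filter, Finset.mem_range]
    omega
  rw [this, Finset.card_range]

lemma pderiv_rowCollapse_eq_zero {K : Type*} [CommSemiring K] {n p : ℕ} [CharP K p] (hp : 0 < p)
    (hpn : p ≤ n) (j : ℕ) {f : MvPolynomial (Fin n × ℕ) K} (hf : f ∈ symAlg K n) :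
    pderiv j (rowCollapse K n p f) = 0 := by
  rw [pderiv_rowCollapse]
  have h (i : Fin n) : rowCollapse K n p (pderiv (i, j) f) *
        pderiv j (rowCollapse K n p (X (i, j))) =
      if (i : ℕ) < p then rowCollapse K n p (pderiv (⟨0, hp.trans_le hpn⟩, j) f) *
        pderiv j (if j ≠ 0 then X j else 0) else 0 := by
    by_cases hi : (i : ℕ) < p
    · simp only [rowCollapse_X, hi, true_and, if_true]
      rw [rowCollapse_pderiv_eq hi (i' := ⟨0, hp.trans_le hpn⟩) hp j hf]
    · simp [rowCollapse_X, hi]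
  rw [Finset.sum_congr rfl fun i _ => h i, sum_ite_val_lt hpn, nsmul_eq_mul,
    CharP.cast_eq_zero, zero_mul]

/-- The polynomial `Σ_i ∏_{j ∈ S} x_{ij}`. -/
noncomputable def colSum (K : Type*) [CommSemiring K] (n : ℕ) (S : Finset ℕ) :
    MvPolynomial (Fin n × ℕ) K :=
  ∑ i : Fin n, ∏ j ∈ S, X (i, j)

lemma colPerm_hPoly (K : Type*) [CommSemiring K] (n k : ℕ) (σ : Equiv.Perm ℕ) :
    colPerm K n σ (hPoly K n k) = colSum K n ((Finset.range k).map σ.toEmbedding) := by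
  simp [colPerm, hPoly, colSum]

lemma rowCollapse_colSum (K : Type*) [CommSemiring K] {n p : ℕ} [CharP K p] (hpn : p ≤ n)
    {S : Finset ℕ} (hS : S.Nonempty) : rowCollapse K n p (colSum K n S) = 0 := by
  simp only [colSum, map_sum, map_prod, rowCollapse_X]
  have h (i : Fin n) : (∏ j ∈ S, if (i : ℕ) < p ∧ j ≠ 0 then (X j : MvPolynomial ℕ K) else 0) =
      if (i : ℕ) < p then ∏ j ∈ S, if j ≠ 0 then X j else 0 else 0 := by
    by_cases hi : (i : ℕ) < p
    · simp [hi]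
    · obtain ⟨j, hj⟩ := hS
      rw [if_neg hi]
      exact Finset.prod_eq_zero hj (by simp [hi])
  rw [Finset.sum_congr rfl fun i _ => h i, sum_ite_val_lt hpn, nsmul_eq_mul,
    CharP.cast_eq_zero, zero_mul]

lemma pderiv_prod_X_of_notMem (K : Type*) {ι κ : Type*} [CommSemiring K] {S : Finset ι}
    {v : ι → κ} {q : κ} (h : ∀ j ∈ S, v j ≠ q) :
    pderiv q (∏ j ∈ S, (X (v j) : MvPolynomial κ K)) = 0 := by
  classical
  induction S using Finset.induction_on with
  | empty => simp
  | insert a S ha ih =>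
    rw [Finset.prod_insert ha, pderiv_mul, ih fun j hj => h j (Finset.mem_insert_of_mem hj),
      pderiv_X_of_ne (h a (Finset.mem_insert_self a S))]
    simp

lemma rowCollapse_pderiv_colSum_of_notMem (K : Type*) [CommSemiring K] (n p : ℕ) (i : Fin n)
    {S : Finset ℕ} (hS : 0 ∉ S) : rowCollapse K n p (pderiv (i, 0) (colSum K n S)) = 0 := by
  rw [colSum, map_sum, Finset.sum_eq_zero, map_zero]
  intro i' _
  exact pderiv_prod_X_of_notMem K fun j hj h => by
    obtain rfl : j = 0 := (Prod.ext_iff.1 h).2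
    exact hS hj

lemma rowCollapse_pderiv_colSum_of_mem (K : Type*) [CommSemiring K] {n p : ℕ} {i : Fin n}
    (hi : (i : ℕ) < p) {S : Finset ℕ} (hS : 0 ∈ S) :
    rowCollapse K n p (pderiv (i, 0) (colSum K n S)) = ∏ j ∈ S.erase 0, X j := by
  have h (i' : Fin n) : pderiv (i, 0) (∏ j ∈ S, (X (i', j) : MvPolynomial (Fin n × ℕ) K)) =
      if i' = i then ∏ j ∈ S.erase 0, X (i, j) else 0 := by
    rw [← Finset.mul_prod_erase S _ hS, pderiv_mul, pderiv_prod_X_of_notMem K (v := fun j => (i', j))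
      fun j hj h => Finset.ne_of_mem_erase hj (Prod.ext_iff.1 h).2]
    by_cases h' : i' = i
    · simp [h']
    · rw [pderiv_X_of_ne fun h => h' (Prod.ext_iff.1 h).1]
      simp [h']
  rw [colSum, map_sum, Finset.sum_congr rfl fun i' _ => h i', Finset.sum_ite_eq' Finset.univ i,
    if_pos (Finset.mem_univ i), map_prod]
  refine Finset.prod_congr rfl fun j hj => ?_
  rw [rowCollapse_X, if_pos ⟨hi, Finset.ne_of_mem_erase hj⟩]

lemma coeff_eq_zero_of_pderiv_eq_zero {K κ : Type*} [CommSemiring K] {F : MvPolynomial κ K}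
    {q : κ} (hF : pderiv q F = 0) {m : κ →₀ ℕ} (hm : m q = 1) : coeff m F = 0 := by
  have hle : Finsupp.single q 1 ≤ m := Finsupp.single_le_iff.2 hm.ge
  have h := coeff_pderiv (i := q) F (m - Finsupp.single q 1)
  simpa [hF, tsub_add_cancel_of_le hle, hm] using h.symm

lemma coeff_mul_prod_X_eq_zero {K κ : Type*} [CommSemiring K] {g : MvPolynomial κ K}
    (hg : ∀ q, pderiv q g = 0) {T U : Finset κ} (hTU : T.card < U.card) :
    coeff (∑ q ∈ U, Finsupp.single q 1) (g * ∏ q ∈ T, X q) = 0 := by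
  classical
  obtain ⟨q, hqU, hqT⟩ := Finset.exists_mem_notMem_of_card_lt_card hTU
  refine coeff_eq_zero_of_pderiv_eq_zero (q := q) ?_ ?_
  · have hT : pderiv q (∏ q ∈ T, (X q : MvPolynomial κ K)) = 0 :=
      pderiv_prod_X_of_notMem K fun j hj h => hqT (h ▸ hj)
    rw [pderiv_mul, hg, hT, zero_mul, mul_zero, add_zero]
  · simp [Finsupp.finsetSum_apply, Finsupp.single_apply, hqU]

lemma coeff_prod_X_self (K : Type*) {κ : Type*} [CommSemiring K] (U : Finset κ) :
    coeff (∑ q ∈ U, Finsupp.single q 1) (∏ q ∈ U, (X q : MvPolynomial κ K)) = 1 := by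
  classical
  have h : ∏ q ∈ U, (X q : MvPolynomial κ K) = monomial (∑ q ∈ U, Finsupp.single q 1) 1 := by
    rw [monomial_sum_one]
    rfl
  rw [h, coeff_monomial, if_pos rfl]

/-- The ideal of `R̄_n` generated by the orbits of `h_1, …, h_m`. -/
noncomputable def hIdeal (K : Type*) [CommSemiring K] (n m : ℕ) : Ideal (symAlg K n) :=
  Ideal.span {y | ∃ σ : Equiv.Perm ℕ, ∃ k < m, y = colPermBar K n σ (hBar K n (k + 1))}

lemma hIdeal_mono (K : Type*) [CommSemiring K] (n : ℕ) : Monotone (hIdeal K n) := by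
  intro a b hab
  refine Ideal.span_mono ?_
  rintro y ⟨σ, k, hk, rfl⟩
  exact ⟨σ, k, hk.trans_le hab, rfl⟩

lemma colPermBar_colPermBar (K : Type*) [CommSemiring K] (n : ℕ) (σ τ : Equiv.Perm ℕ)
    (f : symAlg K n) : colPermBar K n σ (colPermBar K n τ f) = colPermBar K n (σ * τ) f := by
  apply Subtype.ext
  change colPerm K n σ (colPerm K n τ f) = colPerm K n (σ * τ) f
  simp only [colPerm, rename_rename]
  rfl

lemma colPermBar_one (K : Type*) [CommSemiring K] (n : ℕ) (f : symAlg K n) :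
    colPermBar K n 1 f = f :=
  Subtype.ext (rename_id_apply (f : MvPolynomial (Fin n × ℕ) K))

lemma map_colPermBar_hIdeal_le (K : Type*) [CommSemiring K] (n m : ℕ) (σ : Equiv.Perm ℕ) :
    Ideal.map (colPermBar K n σ) (hIdeal K n m) ≤ hIdeal K n m := by
  rw [hIdeal, Ideal.map_span, Ideal.span_le]
  rintro _ ⟨_, ⟨τ, k, hk, rfl⟩, rfl⟩
  exact Ideal.subset_span ⟨σ * τ, k, hk, colPermBar_colPermBar K n σ τ _⟩

lemma map_colPermBar_eq_of_le {K : Type*} [CommSemiring K] {n : ℕ} {I : Ideal (symAlg K n)}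
    (hI : ∀ σ : Equiv.Perm ℕ, Ideal.map (colPermBar K n σ) I ≤ I) (σ : Equiv.Perm ℕ) :
    Ideal.map (colPermBar K n σ) I = I := by
  refine le_antisymm (hI σ) fun f hf => ?_
  have h := Ideal.mem_map_of_mem (colPermBar K n σ)
    (hI σ⁻¹ (Ideal.mem_map_of_mem (colPermBar K n σ⁻¹) hf))
  rwa [colPermBar_colPermBar, mul_inv_cancel, colPermBar_one] at h

lemma hBar_succ_notMem_hIdeal (K : Type*) [Field K] {n p : ℕ} [CharP K p] (hp : 0 < p)
    (hpn : p ≤ n) (m : ℕ) : hBar K n (m + 1) ∉ hIdeal K n m := by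
  intro hmem
  let i : Fin n := ⟨0, hp.trans_le hpn⟩
  set U := (Finset.range (m + 1)).erase 0
  have hU : U.card = m := by simp [U]
  have hvanish : ∀ y ∈ hIdeal K n m, ∀ r : symAlg K n,
      coeff (∑ q ∈ U, Finsupp.single q 1) (rowCollapse K n p
        (pderiv (i, 0) ((r : MvPolynomial (Fin n × ℕ) K) * y))) = 0 := by
    intro y hy
    induction hy using Submodule.span_induction with
    | mem y hy =>
      obtain ⟨σ, k, hk, rfl⟩ := hy
      intro r
      change coeff _ (rowCollapse K n p (pderiv (i, 0) (r * colPerm K n σ (hPoly K n (k + 1))))) = 0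
      rw [colPerm_hPoly]
      set S := (Finset.range (k + 1)).map σ.toEmbedding
      have hS : S.card = k + 1 := by simp [S]
      rw [pderiv_mul, map_add, map_mul, map_mul,
        rowCollapse_colSum K hpn (Finset.card_pos.1 (by omega)), mul_zero, zero_add]
      by_cases h0 : 0 ∈ S
      · rw [rowCollapse_pderiv_colSum_of_mem K hp h0]
        refine coeff_mul_prod_X_eq_zero (fun j => pderiv_rowCollapse_eq_zero hp hpn j r.2) ?_
        rw [Finset.card_erase_of_mem h0]
        omega
      · simp [rowCollapse_pderiv_colSum_of_notMem K n p i h0]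
    | zero => simp
    | add y z _ _ hy hz =>
      intro r
      have := congrArg₂ (· + ·) (hy r) (hz r)
      simpa [mul_add] using this
    | smul a y _ hy =>
      intro r
      have := hy (r * a)
      simpa [mul_assoc] using this
  have h := hvanish _ hmem 1
  have hcol : (hBar K n (m + 1) : MvPolynomial (Fin n × ℕ) K) =
      colSum K n (Finset.range (m + 1)) := rfl
  rw [OneMemClass.coe_one, one_mul, hcol,
    rowCollapse_pderiv_colSum_of_mem K hp (by simp), coeff_prod_X_self] at h
  exact one_ne_zero h

/-- If `K` is a field of characteristic `p` with `0 < p ≤ n`, then `R̄_n`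
contains a `Sym(ℕ)`-invariant ideal that is not finitely generated as a `Sym(ℕ)`-invariant
ideal. -/
theorem exists_symInvariant_ideal_not_fg
    (K : Type) [Field K] (n p : ℕ) [CharP K p] (hp : 0 < p) (hpn : p ≤ n) :
    ∃ I : Ideal (symAlg K n),
      (∀ σ : Equiv.Perm ℕ, Ideal.map (colPermBar K n σ) I = I) ∧
      ¬ ∃ B : Finset (symAlg K n), (↑B : Set (symAlg K n)) ⊆ I ∧
          I = Ideal.span {y | ∃ σ : Equiv.Perm ℕ, ∃ b ∈ B, y = colPermBar K n σ b} := by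
  refine ⟨⨆ m, hIdeal K n m, map_colPermBar_eq_of_le fun σ => ?_, ?_⟩
  · rw [Ideal.map_iSup]
    exact iSup_mono fun m => map_colPermBar_hIdeal_le K n m σ
  rintro ⟨B, hB, hspan⟩
  have hmem (b : symAlg K n) (hb : b ∈ B) : ∃ m, b ∈ hIdeal K n m :=
    (Submodule.mem_iSup_of_directed _ (hIdeal_mono K n).directed_le).1 (hB hb)
  choose! μ hμ using hmem
  have hle : (⨆ m, hIdeal K n m) ≤ hIdeal K n (B.sup μ) := by
    rw [hspan, Ideal.span_le]
    rintro _ ⟨σ, b, hb, rfl⟩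
    exact map_colPermBar_hIdeal_le K n _ σ (Ideal.mem_map_of_mem _
      (hIdeal_mono K n (Finset.le_sup hb) (hμ b hb)))
  refine hBar_succ_notMem_hIdeal K hp hpn (B.sup μ) (hle ?_)
  exact le_iSup (hIdeal K n) (B.sup μ + 1)
    (Ideal.subset_span ⟨1, B.sup μ, Nat.lt_succ_self _, (colPermBar_one K n _).symm⟩)
end

section
/- Let K be a field of characteristic p > 0 and suppose n ≥ p. Then, for each k ∈ ℕ, the polynomial h_k is not contained in the smallest Sym(ℕ)-invariant ideal of R̄_n containing the set { h_l : l ∈ ℕ, l ≠ k }. -/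
open MvPolynomial

/-- The specialisation of `R_n` sending `x_{ij}` to `t_j` if `r i j` holds, and to `0` otherwise. -/
noncomputable def specialize (K : Type*) [CommSemiring K] (n : ℕ) (r : Fin n → ℕ → Prop)
    [∀ i j, Decidable (r i j)] : MvPolynomial (Fin n × ℕ) K →ₐ[K] MvPolynomial ℕ K :=
  aeval (fun q => if r q.1 q.2 then X q.2 else 0)

section Specialize

variable {K : Type*} [CommRing K] {n : ℕ}

lemma specialize_X (r : Fin n → ℕ → Prop) [∀ i j, Decidable (r i j)] (i : Fin n) (j : ℕ) :
    specialize K n r (X (i, j)) = if r i j then X j else 0 := by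
  simp [specialize]

/-- If `r` and `s` agree away from column `j` and `s` excludes column `j`, then the two
specialisations agree modulo `t_j`. -/
lemma X_dvd_specialize_sub (r s : Fin n → ℕ → Prop) [∀ i j, Decidable (r i j)]
    [∀ i j, Decidable (s i j)] (j : ℕ) (hrs : ∀ i, ∀ m ≠ j, (r i m ↔ s i m)) (hs : ∀ i, ¬ s i j)
    (f : MvPolynomial (Fin n × ℕ) K) :
    (X j : MvPolynomial ℕ K) ∣ specialize K n r f - specialize K n s f := by
  induction f using MvPolynomial.induction_on with
  | C a => simp [specialize]
  | add f g hf hg =>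
    rw [map_add, map_add, add_sub_add_comm]
    exact dvd_add hf hg
  | mul_X f q hf =>
    obtain ⟨i, m⟩ := q
    have key : (X j : MvPolynomial ℕ K) ∣
        specialize K n r (X (i, m)) - specialize K n s (X (i, m)) := by
      rw [specialize_X, specialize_X]
      by_cases hm : m = j
      · subst hm
        by_cases h : r i m <;> simp [h, hs i]
      · simp [hrs i m hm]
    rw [map_mul, map_mul]
    exact dvd_mul_sub_mul hf key

/-- The chain rule for `specialize`. -/
lemma pderiv_specialize (r : Fin n → ℕ → Prop) [∀ i j, Decidable (r i j)] (j : ℕ)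
    (f : MvPolynomial (Fin n × ℕ) K) :
    pderiv j (specialize K n r f) =
      ∑ i with r i j, specialize K n r (pderiv (i, j) f) := by
  induction f using MvPolynomial.induction_on with
  | C a => simp [specialize]
  | add f g hf hg => simp [hf, hg, Finset.sum_add_distrib]
  | mul_X f q hf =>
    obtain ⟨i, m⟩ := q
    have key : pderiv j (specialize K n r (X (i, m))) =
        ∑ a with r a j, specialize K n r (pderiv (a, j) (X (i, m))) := by
      rw [specialize_X]
      by_cases hm : m = j
      · subst hm
        by_cases h : r i m
        · rw [Finset.sum_eq_single_of_mem i (by simpa using h)]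
          · simp [h]
          · intro b _ hb
            rw [pderiv_X_of_ne (by simpa using hb.symm), map_zero]
        · rw [if_neg h, map_zero, Finset.sum_eq_zero]
          intro b hb
          rw [pderiv_X_of_ne, map_zero]
          rintro ⟨⟩
          exact h (by simpa using hb)
      · rw [Finset.sum_eq_zero]
        · split_ifs
          · exact pderiv_X_of_ne hm
          · simp
        · intro b _
          rw [pderiv_X_of_ne (by simp [hm]), map_zero]
    simp only [map_mul, pderiv_mul, map_add, Finset.sum_add_distrib, ← Finset.sum_mul,
      ← Finset.mul_sum, key, hf]

/-- A row permutation preserving `r` does not change the specialisation. -/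
lemma specialize_rowPerm (r : Fin n → ℕ → Prop) [∀ i j, Decidable (r i j)]
    (τ : Equiv.Perm (Fin n)) (hτ : ∀ i j, r (τ i) j ↔ r i j) (f : MvPolynomial (Fin n × ℕ) K) :
    specialize K n r (rowPerm K n τ f) = specialize K n r f := by
  simp only [specialize, rowPerm, aeval_rename]
  congr 2
  funext q
  simp [hτ]

/-- If the first `p` rows are specialised in the same way, all others vanish, and `p = 0` in `K`,
then the specialisation of a symmetric polynomial has zero derivative. -/
lemma pderiv_specialize_eq_zero (p : ℕ) [CharP K p] (hp : 0 < p) (hpn : p ≤ n)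
    (c : ℕ → Prop) [DecidablePred c] (j : ℕ) (hj : c j)
    {f : MvPolynomial (Fin n × ℕ) K} (hf : f ∈ symAlg K n) :
    pderiv j (specialize K n (fun i m => i.val < p ∧ c m) f) = 0 := by
  let z : Fin n := ⟨0, hp.trans_le hpn⟩
  have key : ∀ i : Fin n, i.val < p →
      specialize K n (fun i m => i.val < p ∧ c m) (pderiv (i, j) f) =
        specialize K n (fun i m => i.val < p ∧ c m) (pderiv (z, j) f) := by
    intro i hi
    have h1 : pderiv (i, j) f = rowPerm K n (Equiv.swap z i) (pderiv (z, j) f) := by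
      have hinj : Function.Injective
          (fun q : Fin n × ℕ => ((Equiv.swap z i) q.1, q.2)) := by
        rintro ⟨a, b⟩ ⟨c, d⟩ h
        simpa using h
      have h2 := pderiv_rename (R := K) hinj (z, j) f
      simp only [Equiv.swap_apply_left] at h2
      conv_lhs => rw [← hf (Equiv.swap z i)]
      exact h2
    rw [h1, specialize_rowPerm]
    intro a m
    have : ((Equiv.swap z i) a).val < p ↔ a.val < p := by
      rcases eq_or_ne a z with rfl | h
      · simp [hi, z, hp]
      rcases eq_or_ne a i with rfl | h'
      · simp [hi, z, hp]
      rw [Equiv.swap_apply_of_ne_of_ne h h']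
    simp [this]
  rw [pderiv_specialize, Finset.sum_congr rfl (fun i hi => key i (by simp_all)),
    Finset.sum_const]
  have hc : (Finset.univ.filter (fun i : Fin n => i.val < p ∧ c j)).card = p := by
    simp [hj, Fin.card_filter_val_lt, hpn]
  rw [hc, nsmul_eq_mul, CharP.cast_eq_zero, zero_mul]

end Specialize

lemma coeff_eq_zero_of_pderiv_eq_zero_s6 {ι K : Type*} [CommSemiring K] {f : MvPolynomial ι K}
    {j : ι} (hf : pderiv j f = 0) {d : ι →₀ ℕ} (hd : d j = 1) : coeff d f = 0 := by
  classical
  have hd' : d - Finsupp.single j 1 + Finsupp.single j 1 = d :=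
    tsub_add_cancel_of_le (by simp [hd])
  have h := coeff_pderiv (i := j) f (d - Finsupp.single j 1)
  rw [hf, hd'] at h
  simpa [hd] using h.symm

/-- The relation specialising the first `p` rows, where in column `0` only row `0` survives. -/
abbrev anchored (n p : ℕ) (i : Fin n) (j : ℕ) : Prop := i.val < p ∧ (j = 0 → i.val = 0)

lemma coeff_specialize_anchored_eq_zero {K : Type*} [CommRing K] {n p : ℕ} [CharP K p]
    (hp : 0 < p) (hpn : p ≤ n) {f : MvPolynomial (Fin n × ℕ) K} (hf : f ∈ symAlg K n)
    {d : ℕ →₀ ℕ} (hd0 : d 0 = 0) {j : ℕ} (hd : d j = 1) :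
    coeff d (specialize K n (anchored n p) f) = 0 := by
  have hj : j ≠ 0 := by
    rintro rfl
    omega
  obtain ⟨q, hq⟩ := X_dvd_specialize_sub (K := K) (anchored n p)
    (fun i m => i.val < p ∧ m ≠ 0) 0 (fun i m hm => by simp [anchored, hm]) (by simp) f
  rw [sub_eq_iff_eq_add.mp hq, coeff_add, coeff_X_mul', if_neg (by simp [hd0]), zero_add]
  exact coeff_eq_zero_of_pderiv_eq_zero_s6
    (pderiv_specialize_eq_zero p hp hpn (fun m => m ≠ 0) j hj hf) hd

lemma prod_X_eq_monomial {ι K : Type*} [CommSemiring K] (S : Finset ι) :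
    (∏ j ∈ S, X j : MvPolynomial ι K) = monomial (∑ j ∈ S, Finsupp.single j 1) 1 :=
  (monomial_sum_one S _).symm

lemma sum_single_apply {ι : Type*} [DecidableEq ι] (S : Finset ι) (m : ι) :
    (∑ j ∈ S, Finsupp.single j 1 : ι →₀ ℕ) m = if m ∈ S then 1 else 0 := by
  simp [Finsupp.finsetSum_apply, Finsupp.single_apply]

/-- The specialised orbit elements of `h_l` vanish if column `0` is not involved, and are
squarefree monomials otherwise. -/
lemma specialize_anchored_colPerm_hPoly {K : Type*} [CommRing K] {n p : ℕ} [CharP K p]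
    (hp : 0 < p) (hpn : p ≤ n) (σ : Equiv.Perm ℕ) {l : ℕ} (hl : 1 ≤ l) :
    specialize K n (anchored n p) (colPerm K n σ (hPoly K n l)) =
      if 0 ∈ (Finset.range l).map σ.toEmbedding then
        ∏ j ∈ (Finset.range l).map σ.toEmbedding, X j else 0 := by
  have hexp : specialize K n (anchored n p) (colPerm K n σ (hPoly K n l)) =
      ∑ i : Fin n, ∏ j ∈ (Finset.range l).map σ.toEmbedding,
        (if anchored n p i j then X j else 0) := by
    simp only [hPoly, colPerm, map_sum, map_prod, rename_X, specialize_X, Finset.prod_map,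
      Equiv.coe_toEmbedding]
  have hne : ((Finset.range l).map σ.toEmbedding).Nonempty := by
    rw [Finset.map_nonempty, Finset.nonempty_range_iff]
    omega
  rw [hexp]
  generalize (Finset.range l).map σ.toEmbedding = S at hne
  split_ifs with h0
  · rw [Finset.sum_eq_single_of_mem (⟨0, hp.trans_le hpn⟩ : Fin n) (Finset.mem_univ _)]
    · exact Finset.prod_congr rfl fun j _ => if_pos ⟨hp, fun _ => rfl⟩
    · intro i _ hi
      refine Finset.prod_eq_zero h0 (if_neg fun h => hi (Fin.ext (h.2 rfl)))
  · have hterm : ∀ i : Fin n, ∏ j ∈ S, (if anchored n p i j then (X j : MvPolynomial ℕ K) else 0) =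
        if i.val < p then ∏ j ∈ S, X j else 0 := by
      intro i
      split_ifs with hi
      · refine Finset.prod_congr rfl fun j hj => if_pos ⟨hi, fun hj0 => ?_⟩
        exact absurd (hj0 ▸ hj) h0
      · obtain ⟨j, hj⟩ := hne
        exact Finset.prod_eq_zero hj (if_neg fun h => hi h.1)
    have hc : (Finset.univ.filter (fun i : Fin n => i.val < p)).card = p := by
      simp [Fin.card_filter_val_lt, hpn]
    rw [Finset.sum_congr rfl fun i _ => hterm i, ← Finset.sum_filter, Finset.sum_const, hc,
      nsmul_eq_mul, CharP.cast_eq_zero, zero_mul]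

/-- If `K` is a field of characteristic `p > 0` and `n ≥ p`, then for each
`k ∈ ℕ` the polynomial `h_k` is not contained in the smallest `Sym(ℕ)`-invariant ideal of
`R̄_n` containing `{h_l : l ∈ ℕ, l ≠ k}`. -/
theorem hBar_not_mem_span_others
    (K : Type) [Field K] (n p : ℕ) [CharP K p] (hp : 0 < p) (hpn : p ≤ n)
    (k : ℕ) (hk : 1 ≤ k) :
    hBar K n k ∉
      Ideal.span {y | ∃ σ : Equiv.Perm ℕ, ∃ l, 1 ≤ l ∧ l ≠ k ∧ y = colPermBar K n σ (hBar K n l)} := by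
  classical
  intro hmem
  have main : ∀ y ∈ Ideal.span {y | ∃ σ : Equiv.Perm ℕ, ∃ l, 1 ≤ l ∧ l ≠ k ∧
      y = colPermBar K n σ (hBar K n l)}, ∀ a : symAlg K n,
      coeff (∑ j ∈ Finset.range k, Finsupp.single j 1)
        (specialize K n (anchored n p) (a * y : symAlg K n)) = 0 := by
    intro y hy
    induction hy using Submodule.span_induction with
    | mem y hy =>
      obtain ⟨σ, l, hl, hlk, rfl⟩ := hy
      intro a
      have hval : ((a * colPermBar K n σ (hBar K n l) : symAlg K n) :
          MvPolynomial (Fin n × ℕ) K) = a * colPerm K n σ (hPoly K n l) := rfl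
      rw [hval, map_mul, specialize_anchored_colPerm_hPoly hp hpn σ hl]
      have hcard : ((Finset.range l).map σ.toEmbedding).card ≠ k := by simpa using hlk
      generalize (Finset.range l).map σ.toEmbedding = S at hcard
      split_ifs with h0
      · rw [prod_X_eq_monomial, coeff_mul_monomial', mul_one]
        split_ifs with hle
        · have hS : S ⊆ Finset.range k := by
            intro m hm
            have := hle m
            simp only [sum_single_apply, hm, if_true] at this
            by_contra h
            simp [h] at this
          obtain ⟨j, hj, hjS⟩ : ∃ j ∈ Finset.range k, j ∉ S := by
            by_contra! h
            exact hcard (by rw [Finset.Subset.antisymm hS h, Finset.card_range])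
          refine coeff_specialize_anchored_eq_zero hp hpn a.2 (j := j) ?_ ?_
          · rw [Finsupp.tsub_apply, sum_single_apply, sum_single_apply, if_pos h0,
              if_pos (hS h0)]
          · rw [Finsupp.tsub_apply, sum_single_apply, sum_single_apply, if_pos hj,
              if_neg hjS]
        · rfl
      · simp
    | zero => simp
    | add x y _ _ hx hy =>
      intro a
      rw [mul_add, Subalgebra.coe_add, map_add, coeff_add, hx, hy, add_zero]
    | smul b x _ hx =>
      intro a
      rw [smul_eq_mul, ← mul_assoc]
      exact hx (a * b)
  have h := main _ hmem 1
  have hspec := specialize_anchored_colPerm_hPoly (K := K) hp hpn (Equiv.refl ℕ) hk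
  have hid : colPerm K n (Equiv.refl ℕ) (hPoly K n k) = hPoly K n k := rename_id_apply _
  have hmap : (Finset.range k).map (Equiv.refl ℕ).toEmbedding = Finset.range k :=
    Finset.map_refl
  rw [hid, hmap, if_pos (by simpa using Nat.lt_of_succ_le hk), prod_X_eq_monomial] at hspec
  have hval : ((1 * hBar K n k : symAlg K n) : MvPolynomial (Fin n × ℕ) K) = hPoly K n k := by
    rw [one_mul]
    rfl
  rw [hval, hspec, coeff_monomial, if_pos rfl] at h
  exact one_ne_zero h
end

section
/- Let K be a field of characteristic 0, or of characteristic p > n. Let I be a Sym(ℕ)-invariant ideal of R̄_n and let b_1, …, b_k ∈ I. If the ideal I·R_n of R_n generated by I is generated, as a Sym(ℕ)-invariant ideal of R_n, by b_1, …, b_k (i.e., I·R_n equals the ideal of R_n generated by {σ(b_i) : σ ∈ Sym(ℕ), 1 ≤ i ≤ k}), then I is generated, as a Sym(ℕ)-invariant ideal of R̄_n, by b_1, …, b_k (i.e., I equals the ideal of R̄_n generated by {σ(b_i) : σ ∈ Sym(ℕ), 1 ≤ i ≤ k}). -/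
open MvPolynomial

/-- The sum of all row permutations of a polynomial, as a map to the symmetric subalgebra that is
linear over the symmetric subalgebra. -/
noncomputable def rowSum (K : Type*) [CommSemiring K] (n : ℕ) :
    MvPolynomial (Fin n × ℕ) K →ₗ[symAlg K n] symAlg K n where
  toFun f := ⟨∑ τ : Equiv.Perm (Fin n), rowPerm K n τ f, fun τ => by
    rw [map_sum]
    refine Fintype.sum_equiv (Equiv.mulLeft τ) _ _ fun ρ => ?_
    simp only [rowPerm, rename_rename]
    rfl⟩
  map_add' f g := Subtype.ext <| by simp [Finset.sum_add_distrib]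
  map_smul' a f := Subtype.ext <| by
    simp only [Algebra.smul_def, map_mul, RingHom.id_apply, MulMemClass.coe_mul, Finset.mul_sum]
    refine Finset.sum_congr rfl fun τ _ => ?_
    congr 1
    exact a.2 τ

lemma rowSum_coe (K : Type*) [CommSemiring K] (n : ℕ) (a : symAlg K n) :
    rowSum K n a = (n.factorial : K) • a := by
  apply Subtype.ext
  have : ∀ τ : Equiv.Perm (Fin n), rowPerm K n τ a = a := a.2
  change ∑ τ : Equiv.Perm (Fin n), rowPerm K n τ a = (n.factorial : K) • (a : MvPolynomial _ K)
  simp [this, Fintype.card_perm, Nat.cast_smul_eq_nsmul]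

/-- If the row sum is applied to an element of the extension of the ideal spanned by symmetric
polynomials, the result lies in that ideal. -/
lemma rowSum_mem_span (K : Type*) [CommRing K] (n : ℕ) (s : Set (symAlg K n))
    {f : MvPolynomial (Fin n × ℕ) K} (hf : f ∈ Ideal.span ((symAlg K n).val '' s)) :
    rowSum K n f ∈ Ideal.span s := by
  suffices H : ∀ r, rowSum K n (r * f) ∈ Ideal.span s by simpa using H 1
  induction hf using Submodule.span_induction with
  | mem x hx =>
    obtain ⟨a, ha, rfl⟩ := hx
    intro r
    have : r * (symAlg K n).val a = a • r := by rw [Algebra.smul_def, mul_comm]; rfl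
    rw [this, map_smul, smul_eq_mul]
    exact Ideal.mul_mem_right _ _ (Ideal.subset_span ha)
  | zero => simp
  | add x y _ _ hx hy =>
    intro r
    rw [mul_add, map_add]
    exact add_mem (hx r) (hy r)
  | smul c x _ hx =>
    intro r
    rw [smul_eq_mul, ← mul_assoc]
    exact hx (r * c)

lemma factorial_cast_ne_zero_of_charP (K : Type*) [Field K] (n p : ℕ) [CharP K p]
    (hp : p = 0 ∨ n < p) : (n.factorial : K) ≠ 0 := by
  rw [Ne, CharP.cast_eq_zero_iff K p]
  rcases hp with rfl | hp
  · simpa using n.factorial_ne_zero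
  · have : p.Prime := (CharP.char_is_prime_or_zero K p).resolve_right (by omega)
    rw [this.dvd_factorial]
    omega

/-- Let `K` have characteristic `0` or characteristic `p > n`, let `I` be a
`Sym(ℕ)`-invariant ideal of `R̄_n` and `b_1, …, b_k ∈ I`. If the ideal `I·R_n` of `R_n`
generated by `I` is generated, as a `Sym(ℕ)`-invariant ideal of `R_n`, by `b_1, …, b_k`,
then `I` is generated, as a `Sym(ℕ)`-invariant ideal of `R̄_n`, by `b_1, …, b_k`. -/
theorem symInvariant_generators_descend
    (K : Type) [Field K] (n : ℕ) (hn : 1 ≤ n) (p : ℕ) [CharP K p] (hp : p = 0 ∨ n < p)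
    (I : Ideal (symAlg K n))
    (hI : ∀ σ : Equiv.Perm ℕ, Ideal.map (colPermBar K n σ) I = I)
    (k : ℕ) (b : Fin k → symAlg K n) (hb : ∀ i, b i ∈ I)
    (h : Ideal.map (symAlg K n).val I =
        Ideal.span {y : MvPolynomial (Fin n × ℕ) K |
          ∃ σ : Equiv.Perm ℕ, ∃ i : Fin k, y = colPerm K n σ ((b i : MvPolynomial (Fin n × ℕ) K))}) :
    I = Ideal.span {y : symAlg K n | ∃ σ : Equiv.Perm ℕ, ∃ i : Fin k, y = colPermBar K n σ (b i)} := by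
  apply le_antisymm
  · intro a ha
    have hmem : (a : MvPolynomial (Fin n × ℕ) K) ∈ Ideal.span ((symAlg K n).val ''
        {y : symAlg K n | ∃ σ : Equiv.Perm ℕ, ∃ i : Fin k, y = colPermBar K n σ (b i)}) := by
      have h' : (a : MvPolynomial (Fin n × ℕ) K) ∈ Ideal.map (symAlg K n).val I :=
        Ideal.mem_map_of_mem (symAlg K n).val ha
      rw [h] at h'
      refine Ideal.span_mono ?_ h'
      rintro _ ⟨σ, i, rfl⟩
      exact ⟨_, ⟨σ, i, rfl⟩, rfl⟩
    have hsum := rowSum_mem_span K n _ hmem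
    rw [rowSum_coe] at hsum
    have hinv := Submodule.smul_of_tower_mem _ (n.factorial : K)⁻¹ hsum
    rwa [inv_smul_smul₀ (factorial_cast_ne_zero_of_charP K n p hp)] at hinv
  · rw [Ideal.span_le]
    rintro _ ⟨σ, i, rfl⟩
    have := Ideal.mem_map_of_mem (colPermBar K n σ) (hb i)
    rwa [hI σ] at this
end

section
/- Let K be a field of characteristic p > 0 and suppose n ≥ p. Fix k ∈ ℕ. If h_k lies in the smallest Sym(ℕ)-invariant ideal of R̄_n containing { h_l : l ∈ ℕ, l ≠ k }, then the polynomial h_k^{(p)} = Σ_{i=1}^p x_{i1} x_{i2} ⋯ x_{ik} of R_p = K[x_{ij} : 1 ≤ i ≤ p, j ∈ ℕ] lies in the smallest Sym(ℕ)-invariant ideal of R̄_p containing { h_l^{(p)} : l ∈ ℕ, l ≠ k }, where h_l^{(p)} = Σ_{i=1}^p x_{i1} x_{i2} ⋯ x_{il}. -/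
open MvPolynomial

/-- The specialization `R_n → R_m` setting `x_{ij} = 0` for every row `i ≥ m`. -/
noncomputable def truncRows (K : Type*) [CommSemiring K] (n m : ℕ) :
    MvPolynomial (Fin n × ℕ) K →ₐ[K] MvPolynomial (Fin m × ℕ) K :=
  aeval (fun q => if h : (q.1 : ℕ) < m then X (⟨q.1, h⟩, q.2) else 0)

lemma truncRows_X_castLE (K : Type*) [CommSemiring K] {n m : ℕ} (hmn : m ≤ n) (i : Fin m)
    (j : ℕ) : truncRows K n m (X (Fin.castLE hmn i, j)) = X (i, j) := by
  simp [truncRows]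

lemma truncRows_X_of_le (K : Type*) [CommSemiring K] {n m : ℕ} (i : Fin n) (hi : m ≤ (i : ℕ))
    (j : ℕ) : truncRows K n m (X (i, j)) = 0 := by
  simp [truncRows, hi]

lemma truncRows_colPerm (K : Type*) [CommSemiring K] (n m : ℕ) (σ : Equiv.Perm ℕ)
    (f : MvPolynomial (Fin n × ℕ) K) :
    truncRows K n m (colPerm K n σ f) = colPerm K m σ (truncRows K n m f) := by
  refine DFunLike.congr_fun (f := (truncRows K n m).comp (colPerm K n σ))
    (g := (colPerm K m σ).comp (truncRows K n m)) (MvPolynomial.algHom_ext fun q => ?_) f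
  by_cases h : (q.1 : ℕ) < m
  · simp [truncRows, colPerm, h]
  · simp [truncRows, colPerm, h]

/-- A permutation of the first `m` rows, extended to all rows by the identity, is compatible with
the specialization to the first `m` rows. -/
lemma truncRows_rowPerm_viaEmbedding (K : Type*) [CommSemiring K] {n m : ℕ} (hmn : m ≤ n)
    (τ : Equiv.Perm (Fin m)) (f : MvPolynomial (Fin n × ℕ) K) :
    truncRows K n m (rowPerm K n (τ.viaEmbedding (Fin.castLEEmb hmn)) f) =
      rowPerm K m τ (truncRows K n m f) := by
  refine DFunLike.congr_fun
    (f := (truncRows K n m).comp (rowPerm K n (τ.viaEmbedding (Fin.castLEEmb hmn))))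
    (g := (rowPerm K m τ).comp (truncRows K n m)) (MvPolynomial.algHom_ext ?_) f
  rintro ⟨i, j⟩
  simp only [AlgHom.comp_apply, rowPerm, rename_X]
  by_cases h : (i : ℕ) < m
  · obtain ⟨i, rfl⟩ : ∃ i' : Fin m, Fin.castLE hmn i' = i := ⟨⟨i, h⟩, rfl⟩
    have hτ : τ.viaEmbedding (Fin.castLEEmb hmn) (Fin.castLE hmn i) = Fin.castLE hmn (τ i) :=
      τ.viaEmbedding_apply (Fin.castLEEmb hmn) i
    rw [hτ, truncRows_X_castLE, truncRows_X_castLE, rename_X]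
  · have hi : i ∉ Set.range (Fin.castLEEmb hmn) := by
      rintro ⟨i', rfl⟩
      exact h i'.2
    rw [τ.viaEmbedding_apply_of_notMem _ i hi, truncRows_X_of_le K i (not_lt.mp h), map_zero]

lemma truncRows_mem_symAlg (K : Type*) [CommSemiring K] {n m : ℕ} (hmn : m ≤ n)
    {f : MvPolynomial (Fin n × ℕ) K} (hf : f ∈ symAlg K n) :
    truncRows K n m f ∈ symAlg K m := by
  intro τ
  rw [← truncRows_rowPerm_viaEmbedding K hmn, hf]

/-- The specialization to the first `m` rows, restricted to symmetric polynomials. -/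
noncomputable def truncRowsBar (K : Type*) [CommSemiring K] {n m : ℕ} (hmn : m ≤ n) :
    symAlg K n →ₐ[K] symAlg K m :=
  ((truncRows K n m).comp (symAlg K n).val).codRestrict (symAlg K m)
    (fun x => truncRows_mem_symAlg K hmn x.2)

lemma truncRowsBar_colPermBar (K : Type*) [CommSemiring K] {n m : ℕ} (hmn : m ≤ n)
    (σ : Equiv.Perm ℕ) (f : symAlg K n) :
    truncRowsBar K hmn (colPermBar K n σ f) = colPermBar K m σ (truncRowsBar K hmn f) :=
  Subtype.ext (truncRows_colPerm K n m σ f)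

lemma truncRows_hPoly (K : Type*) [CommSemiring K] {n m : ℕ} (hmn : m ≤ n) {l : ℕ}
    (hl : 1 ≤ l) : truncRows K n m (hPoly K n l) = hPoly K m l := by
  simp only [hPoly, map_sum, map_prod]
  symm
  refine Finset.sum_of_injOn (Fin.castLE hmn) (Fin.castLE_injective hmn).injOn (by simp) ?_ ?_
  · intro i _ hi
    have him : m ≤ (i : ℕ) := by
      by_contra! h
      exact hi ⟨⟨i, h⟩, by simp, rfl⟩
    exact Finset.prod_eq_zero (Finset.mem_range.mpr hl) (truncRows_X_of_le K i him 0)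
  · intro i _
    simp only [truncRows_X_castLE]

lemma truncRowsBar_hBar (K : Type*) [CommSemiring K] {n m : ℕ} (hmn : m ≤ n) {l : ℕ}
    (hl : 1 ≤ l) : truncRowsBar K hmn (hBar K n l) = hBar K m l :=
  Subtype.ext (truncRows_hPoly K hmn hl)

/-- reduction from `n` rows to `p` rows. Let `K` be a field of
characteristic `p > 0`, `n ≥ p` and fix `k`. If `h_k` lies in the smallest
`Sym(ℕ)`-invariant ideal of `R̄_n` containing `{h_l : l ≠ k}`, then the corresponding
polynomial `h_k^{(p)} = Σ_{i=1}^p x_{i1}⋯x_{ik}` of `R_p` lies in the smallest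
`Sym(ℕ)`-invariant ideal of `R̄_p` containing `{h_l^{(p)} : l ≠ k}`. -/
theorem hBar_mem_span_others_reduction_rows
    (K : Type) [Field K] (n p : ℕ) [CharP K p] (hp : 0 < p) (hpn : p ≤ n)
    (k : ℕ) (hk : 1 ≤ k)
    (h : hBar K n k ∈
      Ideal.span {y | ∃ σ : Equiv.Perm ℕ, ∃ l, 1 ≤ l ∧ l ≠ k ∧ y = colPermBar K n σ (hBar K n l)}) :
    hBar K p k ∈
      Ideal.span {y | ∃ σ : Equiv.Perm ℕ, ∃ l, 1 ≤ l ∧ l ≠ k ∧ y = colPermBar K p σ (hBar K p l)} := by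
  rw [← truncRowsBar_hBar K hpn hk, ← Ideal.mem_comap]
  refine Ideal.span_le.mpr ?_ h
  rintro _ ⟨σ, l, hl, hlk, rfl⟩
  refine Ideal.subset_span ⟨σ, l, hl, hlk, ?_⟩
  rw [truncRowsBar_colPermBar, truncRowsBar_hBar K hpn hl]
end

section
/- Let K be a field of characteristic p > 0, with prime subfield 𝔽_p = ℤ/pℤ, and let n = p. Fix k ∈ ℕ. If h_k (with coefficients in K) lies in the smallest Sym(ℕ)-invariant ideal of R̄_p over K containing { h_l : l ∈ ℕ, l ≠ k }, then h_k with coefficients in 𝔽_p lies in the smallest Sym(ℕ)-invariant ideal of the symmetric subalgebra R̄_{p,𝔽_p} of 𝔽_p[x_{ij} : 1 ≤ i ≤ p, j ∈ ℕ] containing { h_l : l ∈ ℕ, l ≠ k } (with coefficients in 𝔽_p). -/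
open MvPolynomial

/-- Apply a linear functional `φ : K → F` to each coefficient of a polynomial. -/
noncomputable def coeffMap {ι F K : Type*} [CommSemiring F] [CommSemiring K] [Algebra F K]
    (φ : K →ₗ[F] F) (f : MvPolynomial ι K) : MvPolynomial ι F :=
  ∑ m ∈ f.support, monomial m (φ (coeff m f))

section coeffMap

variable {ι κ F K : Type*} [CommSemiring F] [CommSemiring K] [Algebra F K] (φ : K →ₗ[F] F)

lemma coeff_coeffMap (f : MvPolynomial ι K) (m : ι →₀ ℕ) :
    coeff m (coeffMap φ f) = φ (coeff m f) := by
  classical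
  simp only [coeffMap, coeff_sum, coeff_monomial, Finset.sum_ite_eq', mem_support_iff]
  split_ifs with h
  · rfl
  · rw [not_not.mp h, map_zero]

lemma coeffMap_add (f g : MvPolynomial ι K) :
    coeffMap φ (f + g) = coeffMap φ f + coeffMap φ g := by
  ext m
  simp [coeff_coeffMap]

lemma coeffMap_monomial (m : ι →₀ ℕ) (a : K) :
    coeffMap φ (monomial m a) = monomial m (φ a) := by
  classical
  ext d
  simp only [coeff_coeffMap, coeff_monomial]
  split_ifs <;> simp

lemma coeffMap_mul_map (f : MvPolynomial ι K) (g : MvPolynomial ι F) :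
    coeffMap φ (f * map (algebraMap F K) g) = coeffMap φ f * g := by
  classical
  ext m
  simp only [coeff_coeffMap, coeff_mul, map_sum, coeff_map]
  refine Finset.sum_congr rfl fun x _ => ?_
  rw [mul_comm, ← Algebra.smul_def, map_smul, smul_eq_mul, mul_comm]

lemma rename_coeffMap (e : ι → κ) (f : MvPolynomial ι K) :
    rename e (coeffMap φ f) = coeffMap φ (rename e f) := by
  induction f using MvPolynomial.induction_on' with
  | monomial m a => simp only [coeffMap_monomial, rename_monomial]
  | add f g hf hg => simp only [coeffMap_add, map_add, hf, hg]

end coeffMap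

section symAlg

variable {F K : Type*} [CommSemiring F] [CommSemiring K] [Algebra F K] (φ : K →ₗ[F] F) (n : ℕ)

/-- The restriction of `coeffMap φ` to the symmetric subalgebras. -/
noncomputable def coeffMapBar : symAlg K n →+ symAlg F n where
  toFun f := ⟨coeffMap φ f.1, fun τ => by
    rw [rowPerm, rename_coeffMap]
    exact congrArg _ (f.2 τ)⟩
  map_zero' := Subtype.ext (by simp [coeffMap])
  map_add' f g := Subtype.ext (coeffMap_add φ f.1 g.1)

lemma map_hPoly (k : ℕ) : map (algebraMap F K) (hPoly F n k) = hPoly K n k := by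
  simp [hPoly]

lemma coeffMapBar_mul_colPermBar_hBar (a : symAlg K n) (σ : Equiv.Perm ℕ) (l : ℕ) :
    coeffMapBar φ n (a * colPermBar K n σ (hBar K n l)) =
      coeffMapBar φ n a * colPermBar F n σ (hBar F n l) := by
  refine Subtype.ext ?_
  change coeffMap φ (a.1 * colPerm K n σ (hPoly K n l)) =
    coeffMap φ a.1 * colPerm F n σ (hPoly F n l)
  rw [← coeffMap_mul_map, colPerm, colPerm, map_rename, map_hPoly]

lemma coeffMapBar_hBar (hφ : φ 1 = 1) (k : ℕ) :
    coeffMapBar φ n (hBar K n k) = hBar F n k := by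
  refine Subtype.ext ?_
  change coeffMap φ (hPoly K n k) = hPoly F n k
  ext m
  rw [coeff_coeffMap, ← map_hPoly (F := F), coeff_map, Algebra.algebraMap_eq_smul_one, map_smul,
    hφ, smul_eq_mul, mul_one]

end symAlg

/-- reduction of the coefficient field to the prime field `𝔽_p = ℤ/pℤ`.
Let `K` be a field of characteristic `p > 0` and `n = p`. If `h_k` over `K` lies in the
smallest `Sym(ℕ)`-invariant ideal of `R̄_p` over `K` containing `{h_l : l ≠ k}`, then `h_k`
over `𝔽_p` lies in the smallest `Sym(ℕ)`-invariant ideal of `R̄_{p,𝔽_p}` containing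
`{h_l : l ≠ k}`. -/
theorem hBar_mem_span_others_reduction_field
    (K : Type) [Field K] (p : ℕ) [CharP K p] (hp : 0 < p) (k : ℕ) (hk : 1 ≤ k)
    (h : hBar K p k ∈
      Ideal.span {y | ∃ σ : Equiv.Perm ℕ, ∃ l, 1 ≤ l ∧ l ≠ k ∧ y = colPermBar K p σ (hBar K p l)}) :
    hBar (ZMod p) p k ∈
      Ideal.span {y | ∃ σ : Equiv.Perm ℕ, ∃ l, 1 ≤ l ∧ l ≠ k ∧
        y = colPermBar (ZMod p) p σ (hBar (ZMod p) p l)} := by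
  have : Fact p.Prime := ⟨(CharP.char_is_prime_or_zero K p).resolve_right hp.ne'⟩
  let : Algebra (ZMod p) K := ZMod.algebra K p
  obtain ⟨φ, hφ⟩ := LinearMap.exists_leftInverse_of_injective (Algebra.linearMap (ZMod p) K)
    (LinearMap.ker_eq_bot.mpr (algebraMap (ZMod p) K).injective)
  have hφ_one : φ 1 = 1 := by simpa using LinearMap.congr_fun hφ 1
  set J := Ideal.span {y | ∃ σ : Equiv.Perm ℕ, ∃ l, 1 ≤ l ∧ l ≠ k ∧
    y = colPermBar (ZMod p) p σ (hBar (ZMod p) p l)}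
  suffices H : ∀ a, coeffMapBar φ p (a * hBar K p k) ∈ J by
    simpa [coeffMapBar_hBar φ p hφ_one] using H 1
  generalize hBar K p k = f at h ⊢
  induction h using Submodule.span_induction with
  | mem y hy =>
    obtain ⟨σ, l, hl, hlk, rfl⟩ := hy
    intro a
    rw [coeffMapBar_mul_colPermBar_hBar]
    exact J.mul_mem_left _ (Ideal.subset_span ⟨σ, l, hl, hlk, rfl⟩)
  | zero => simp
  | add y z _ _ hy hz =>
    intro a
    rw [mul_add, map_add]
    exact J.add_mem (hy a) (hz a)
  | smul r y _ hy =>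
    intro a
    rw [smul_eq_mul, ← mul_assoc]
    exact hy (a * r)
end
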